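/- arXiv:2112.03782 — 2 statements merged into one kernel-verified Lean document; each statement's English description precedes it below -/
import Mathlib

section
/- The only solutions in positive integers (y1, y2) to the equation y1^2 + 1 = 2·y2^4 are (y1, y2) = (1, 1) and (y1, y2) = (239, 13). -/
open Finset in
def ljFF (n c : ℕ) : ℕ := ∏ i ∈ range n, (4 * i + c)

lemma ljFF_add (a b c : ℕ) : ljFF (a + b) c = ljFF a c * ljFF b (4 * a + c) := by
  unfold ljFF
  rw [Finset.prod_range_add]
  congr 1
  apply Finset.prod_congr rfl
  intros; ring

lemma ljFF_pos (n c : ℕ) (hc : 0 < c) : 0 < ljFF n c :=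
  Finset.prod_pos (fun i _ => by omega)

lemma ljFF_dvd (n c : ℕ) : n.factorial ∣ 2 ^ n * ljFF n c := by
  obtain ⟨e, m, hm, hem⟩ := Nat.exists_eq_two_pow_mul_odd (Nat.factorial_ne_zero n)
  have he : e ≤ n := by
    rcases Nat.eq_zero_or_pos n with rfl | hn
    · by_contra h
      have : 2 ∣ Nat.factorial 0 := by
        rw [hem]; exact Dvd.dvd.mul_right (dvd_pow_self 2 (by omega)) _
      simp at this
    · have h1 := Nat.emultiplicity_two_factorial_lt (n := n) (by omega)
      have h2 : ((e : ℕ) : ℕ∞) ≤ emultiplicity 2 n.factorial := by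
        apply le_emultiplicity_of_pow_dvd
        rw [hem]; exact Dvd.intro _ rfl
      have := h2.trans_lt h1
      exact_mod_cast this.le
  rw [hem]
  apply mul_dvd_mul (pow_dvd_pow 2 he)
  -- choose N with 4 * N ≡ c mod m
  have hcop : Nat.Coprime 4 m := by
    have : Nat.Coprime 2 m := (Nat.coprime_two_left).2 hm
    exact Nat.Coprime.pow_left 2 this
  have hu : IsUnit ((4 : ℕ) : ZMod m) := (ZMod.isUnit_iff_coprime 4 m).2 hcop
  obtain ⟨v, hv⟩ := hu.exists_right_inv
  have hmpos : NeZero m := ⟨by rintro rfl; simp at hm⟩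
  set N : ℕ := (v * (c : ZMod m)).val with hN
  have hN' : (4 : ZMod m) * (N : ZMod m) = c := by
    rw [hN, ZMod.natCast_zmod_val, ← mul_assoc]
    push_cast at hv
    rw [hv, one_mul]
  rw [← ZMod.natCast_eq_zero_iff]
  unfold ljFF
  push_cast
  have : ∀ i ∈ Finset.range n, (4 * (i : ZMod m) + c) = 4 * ((N + i : ℕ) : ZMod m) := by
    intro i _
    rw [← hN']; push_cast; ring
  rw [Finset.prod_congr rfl this, Finset.prod_mul_distrib, ← Nat.cast_prod,
    ← Nat.ascFactorial_eq_prod_range]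
  have h3 : m ∣ N.ascFactorial n :=
    (Dvd.intro_left _ hem.symm).trans (Nat.factorial_dvd_ascFactorial _ _)
  rw [(ZMod.natCast_eq_zero_iff _ _).2 h3, mul_zero]

/-- partial fractions -/
lemma lj_pf (r : ℕ) : ∀ x : ℂ, (∀ j : ℕ, j ≤ r → x + j ≠ 0) →
    ∑ j ∈ Finset.range (r + 1), (-1 : ℂ) ^ j * (r.choose j) / (x + j) =
      r.factorial / ∏ j ∈ Finset.range (r + 1), (x + j) := by
  induction r with
  | zero => intro x hx; simp
  | succ r ih =>
    intro x hx
    have e1 : ∑ j ∈ Finset.range (r + 1 + 1), (-1 : ℂ) ^ j * ((r+1).choose j) / (x + j)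
      = ∑ j ∈ Finset.range (r + 1), (-1 : ℂ) ^ j * (r.choose j) / (x + j)
        - ∑ j ∈ Finset.range (r + 1), (-1 : ℂ) ^ j * (r.choose j) / ((x + 1) + j) := by
      rw [Finset.sum_range_succ' _ (r+1)]
      have : ∑ j ∈ Finset.range (r + 1), (-1 : ℂ) ^ j * (r.choose j) / (x + j) =
        ∑ j ∈ Finset.range (r + 1), (-1 : ℂ) ^ (j+1) * (r.choose (j+1)) / (x + (j+1 : ℕ))
          + (-1 : ℂ) ^ 0 * (r.choose 0) / (x + (0:ℕ)) := by
        rw [← Finset.sum_range_succ' (fun j : ℕ => (-1 : ℂ) ^ j * (r.choose j) / (x + j)) (r+1),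
          Finset.sum_range_succ _ (r+1)]
        simp
      rw [this]
      have : ∀ j ∈ Finset.range (r+1), (-1 : ℂ) ^ (j+1) * ((r+1).choose (j+1)) / (x + (j+1 : ℕ))
        = (-1 : ℂ) ^ (j+1) * (r.choose (j+1)) / (x + (j+1 : ℕ))
          - (-1 : ℂ) ^ j * (r.choose j) / ((x + 1) + j) := by
        intro j _
        rw [Nat.choose_succ_succ]
        push_cast
        rw [show x + ((j:ℂ) + 1) = x + 1 + j by ring]
        ring
      rw [Finset.sum_congr rfl this, Finset.sum_sub_distrib]
      simp
      ring
    rw [e1, ih x (fun j hj => hx j (by omega)), ih (x+1) (fun j hj => by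
      have := hx (j+1) (by omega)
      push_cast at this
      intro h; apply this; rw [← h]; ring)]
    have hP1 : ∏ j ∈ Finset.range (r + 1 + 1), (x + (j:ℂ)) =
       (∏ j ∈ Finset.range (r + 1), (x + (j:ℂ))) * (x + (r+1 : ℕ)) := Finset.prod_range_succ _ _
    have hP2 : ∏ j ∈ Finset.range (r + 1 + 1), (x + (j:ℂ)) =
       (∏ j ∈ Finset.range (r + 1), (x + 1 + (j:ℂ))) * x := by
      rw [Finset.prod_range_succ']
      simp only [Nat.cast_zero, add_zero]
      congr 1
      apply Finset.prod_congr rfl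
      intros; push_cast; ring
    have hn : ∏ j ∈ Finset.range (r + 1 + 1), (x + (j:ℂ)) ≠ 0 := by
      rw [Finset.prod_ne_zero_iff]; intro j hj; exact hx j (by simp at hj; omega)
    set P := ∏ j ∈ Finset.range (r + 1 + 1), (x + (j:ℂ))
    set P1 := ∏ j ∈ Finset.range (r + 1), (x + (j:ℂ))
    set P2 := ∏ j ∈ Finset.range (r + 1), (x + 1 + (j:ℂ))
    have h1 : P1 ≠ 0 := by rintro h; rw [h] at hP1; simp [hP1] at hn
    have h2 : P2 ≠ 0 := by rintro h; rw [h] at hP2; simp [hP2] at hn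
    have e2 : (r.factorial : ℂ) / P1 = r.factorial * (x + (r+1:ℕ)) / P := by
      rw [div_eq_div_iff h1 hn, hP1]; ring
    have e3 : (r.factorial : ℂ) / P2 = r.factorial * x / P := by
      rw [div_eq_div_iff h2 hn, hP2]; ring
    rw [e2, e3, Nat.factorial_succ]
    push_cast
    ring

noncomputable def ljS (r k : ℕ) : ℂ :=
  ∑ j ∈ Finset.range (r + 1), (-1 : ℂ) ^ j * (r.choose j) / (4 * ((j : ℂ) - k) + 1)

noncomputable def ljA (r k : ℕ) : ℂ := (r.choose k) * (-1) ^ k * ljS r k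

lemma lj_den_ne (j k : ℤ) : (4 * ((j : ℂ) - k) + 1) ≠ 0 := by
  intro h
  have : (4 * (j - k) + 1 : ℤ) = 0 := by exact_mod_cast h
  omega

lemma ljS_eq (r k : ℕ) : ljS r k = 4 ^ r * r.factorial /
    ∏ j ∈ Finset.range (r + 1), (4 * ((j : ℂ) - k) + 1) := by
  have key := lj_pf r (1/4 - k) (fun j hj h => by
    apply lj_den_ne j k
    push_cast
    linear_combination 4 * h)
  have h1 : ljS r k = (1/4) * ∑ j ∈ Finset.range (r + 1),
      (-1 : ℂ) ^ j * (r.choose j) / ((1/4 - k) + j) := by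
    unfold ljS
    rw [Finset.mul_sum]
    apply Finset.sum_congr rfl
    intro j _
    have := lj_den_ne j k
    push_cast at this
    rw [show (1/4 - (k:ℂ) + j) = (4 * ((j : ℂ) - k) + 1)/4 by ring]
    field_simp
  have h2 : ∏ j ∈ Finset.range (r + 1), (4 * ((j : ℂ) - k) + 1) =
    4 ^ (r+1) * ∏ j ∈ Finset.range (r + 1), ((1/4 - (k:ℂ)) + j) := by
    rw [Finset.pow_eq_prod_const, ← Finset.prod_mul_distrib]
    apply Finset.prod_congr rfl
    intros; ring
  have h3 : ∏ j ∈ Finset.range (r + 1), (4 * ((j : ℂ) - k) + 1) ≠ 0 := by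
    rw [Finset.prod_ne_zero_iff]; intro j _; exact_mod_cast lj_den_ne j k
  have h4 : ∏ j ∈ Finset.range (r + 1), ((1/4 - (k:ℂ)) + j) ≠ 0 := by
    intro h; rw [h] at h2; simp [h2] at h3
  rw [h1, key, h2, pow_succ]
  field_simp

lemma lj_prod (k m : ℕ) : ∏ j ∈ Finset.range (k + m + 1), (4 * ((j : ℂ) - k) + 1) =
    (-1) ^ k * ljFF k 3 * ljFF (m + 1) 1 := by
  rw [add_assoc, Finset.prod_range_add, ← Finset.prod_range_reflect]
  unfold ljFF
  push_cast
  rw [← Finset.card_range k, ← Finset.prod_const, Finset.card_range, ← Finset.prod_mul_distrib]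
  congr 1
  · apply Finset.prod_congr rfl
    intro j hj
    have : j < k := by simpa using hj
    rw [show k - 1 - j = k - (j+1) by omega, Nat.cast_sub (by omega)]
    push_cast; ring
  · apply Finset.prod_congr rfl
    intros; ring

def ljC (r k : ℕ) : ℕ :=
  (2 ^ (r-k) * ljFF (r-k) (4*k+3) / (r-k).factorial) * (2 ^ k * ljFF k (4*(r-k)+5) / k.factorial)

noncomputable def ljK (r : ℕ) : ℝ := ljFF r 3 * ljFF (r+1) 1 / (2 ^ r * (r.factorial : ℝ) ^ 2)

lemma ljK_mul (r k : ℕ) (hk : k ≤ r) : (ljK r : ℂ) * ljA r k = ljC r k := by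
  obtain ⟨m, rfl⟩ := Nat.exists_eq_add_of_le hk
  unfold ljA ljC ljK
  rw [ljS_eq, lj_prod, Nat.add_sub_cancel_left, ljFF_add k m 3,
    show k + m + 1 = (m + 1) + k by ring, ljFF_add (m+1) k 1]
  have f1 : ((2 ^ m * ljFF m (4*k+3) / m.factorial : ℕ) : ℂ) =
    2 ^ m * ljFF m (4*k+3) / m.factorial := by
    rw [Nat.cast_div (ljFF_dvd _ _) (by exact_mod_cast Nat.factorial_ne_zero m)]; push_cast; rfl
  have f2 : ((2 ^ k * ljFF k (4*m+5) / k.factorial : ℕ) : ℂ) =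
    2 ^ k * ljFF k (4*m+5) / k.factorial := by
    rw [Nat.cast_div (ljFF_dvd _ _) (by exact_mod_cast Nat.factorial_ne_zero k)]; push_cast; rfl
  have f3 : ((2 ^ m * ljFF m (4*k+3) / m.factorial * (2 ^ k * ljFF k (4*m+5) / k.factorial) : ℕ) : ℂ)
    = 2 ^ m * ljFF m (4*k+3) / m.factorial * (2 ^ k * ljFF k (4*m+5) / k.factorial) := by
    rw [Nat.cast_mul, f1, f2]
  rw [f3]
  have c1 : ((k+m).choose k : ℂ) = (k+m).factorial / (k.factorial * m.factorial) := by
    rw [Nat.cast_choose ℂ (by omega), Nat.add_sub_cancel_left]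
  rw [c1, show 4 * (m+1) + 1 = 4*m+5 by ring]
  have g1 : (ljFF k 3 : ℂ) ≠ 0 := by exact_mod_cast (ljFF_pos _ _ (by norm_num)).ne'
  have g2 : (ljFF (m+1) 1 : ℂ) ≠ 0 := by exact_mod_cast (ljFF_pos _ _ (by norm_num)).ne'
  have g3 : ((k+m).factorial : ℂ) ≠ 0 := by exact_mod_cast (Nat.factorial_ne_zero _)
  have g4 : ((k).factorial : ℂ) ≠ 0 := by exact_mod_cast (Nat.factorial_ne_zero _)
  have g5 : ((m).factorial : ℂ) ≠ 0 := by exact_mod_cast (Nat.factorial_ne_zero _)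
  push_cast
  have g6 : ((-1:ℂ)^k) ≠ 0 := by simp
  have h4 : (4:ℂ)^(k+m) = 2^(k+m) * 2^(k+m) := by rw [← mul_pow]; norm_num
  rw [h4]
  field_simp
  ring

lemma ljK_pos (r : ℕ) : 0 < ljK r := by
  unfold ljK
  have g1 : (0:ℝ) < (ljFF r 3 : ℝ) := by exact_mod_cast (ljFF_pos _ _ (by norm_num))
  have g2 : (0:ℝ) < (ljFF (r+1) 1 : ℝ) := by exact_mod_cast (ljFF_pos _ _ (by norm_num))
  positivity

lemma ljK_le (r : ℕ) : ljK r ≤ 8 ^ r := by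
  unfold ljK
  rw [div_le_iff₀ (by positivity)]
  have : ljFF r 3 * ljFF (r+1) 1 ≤ 16 ^ r * r.factorial ^ 2 := by
    induction r with
    | zero => simp [ljFF]
    | succ r ih =>
      unfold ljFF at *
      rw [Finset.prod_range_succ, Finset.prod_range_succ _ (r+1), Nat.factorial_succ]
      calc _ = ((∏ x ∈ Finset.range r, (4 * x + 3)) * (∏ x ∈ Finset.range (r+1), (4 * x + 1)))
          * ((4*r+3)*(4*(r+1)+1)) := by ring
        _ ≤ (16 ^ r * r.factorial ^ 2) * (16 * (r+1)^2) := by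
          apply Nat.mul_le_mul ih; nlinarith
        _ = _ := by ring
  calc (ljFF r 3 * ljFF (r+1) 1 : ℝ) ≤ 16 ^ r * (r.factorial:ℝ) ^ 2 := by exact_mod_cast this
    _ = _ := by rw [← mul_assoc, ← mul_pow]; norm_num

lemma ljC_le (r k : ℕ) (hk : k ≤ r) : ljC r k ≤ 8 ^ r * (r.choose k * (r+1).choose k) := by
  obtain ⟨m, rfl⟩ := Nat.exists_eq_add_of_le hk
  have gen : ∀ n b c, c ≤ 4 * b → 2 ^ n * ljFF n c / n.factorial ≤ 8 ^ n * (b + n - 1).choose n := by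
    intro n b c hc
    apply Nat.div_le_of_le_mul
    have : ljFF n c ≤ 4 ^ n * b.ascFactorial n := by
      unfold ljFF
      rw [Nat.ascFactorial_eq_prod_range, Finset.pow_eq_prod_const, ← Finset.prod_mul_distrib]
      apply Finset.prod_le_prod'
      intros; omega
    rw [Nat.ascFactorial_eq_factorial_mul_choose'] at this
    calc _ ≤ 2 ^ n * (4 ^ n * (n.factorial * (b + n - 1).choose n)) := Nat.mul_le_mul_left _ this
      _ = n.factorial * ((2*4)^n * (b + n - 1).choose n) := by rw [mul_pow]; ring
  unfold ljC
  rw [Nat.add_sub_cancel_left]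
  have h1 := gen m (k+1) (4*k+3) (by omega)
  have h2 := gen k (m+2) (4*m+5) (by omega)
  refine (Nat.mul_le_mul h1 h2).trans ?_
  rw [show k + 1 + m - 1 = k + m by omega, show m + 2 + k - 1 = k + m + 1 by omega,
    Nat.choose_symm_add]
  apply le_of_eq
  ring

lemma ljC_sum (r : ℕ) : ∑ k ∈ Finset.range (r+1), ljC r k ≤ 2 * 32 ^ r := by
  calc _ ≤ ∑ k ∈ Finset.range (r+1), 8 ^ r * (2 ^ (r+1) * r.choose k) := by
        apply Finset.sum_le_sum
        intro k hk
        refine (ljC_le r k (by simp at hk; omega)).trans ?_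
        apply Nat.mul_le_mul_left
        rw [mul_comm]
        exact Nat.mul_le_mul_right _ (Nat.choose_le_two_pow _ _)
    _ = 2 * 32 ^ r := by
        rw [← Finset.mul_sum, ← Finset.mul_sum, Nat.sum_range_choose, show 32 = 8*2*2 by norm_num,
          mul_pow, mul_pow]
        ring

noncomputable def ljPA (r : ℕ) (z : ℂ) : ℂ := ∑ k ∈ Finset.range (r+1), ljA r k * z ^ k
noncomputable def ljPB (r : ℕ) (z : ℂ) : ℂ := ∑ k ∈ Finset.range (r+1), ljA r k * z ^ (r - k)

noncomputable def ljG (r : ℕ) (z s : ℂ) : ℂ :=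
  ∑ k ∈ Finset.range (r+1), ∑ j ∈ Finset.range (r+1),
    ((-1 : ℂ) ^ k * (r.choose k) * z ^ k) * ((-1 : ℂ) ^ j * (r.choose j)) *
      (s ^ (4 * ((j : ℤ) - k) + 1) / (4 * ((j : ℂ) - k) + 1))

lemma ljG_deriv (r : ℕ) (z s : ℂ) (hs : s ≠ 0) :
    HasDerivAt (ljG r z) (((z - s ^ 4) * (s ^ 4 - 1) / s ^ 4) ^ r) s := by
  have h1 : HasDerivAt (ljG r z) (∑ k ∈ Finset.range (r+1), ∑ j ∈ Finset.range (r+1),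
    ((-1 : ℂ) ^ k * (r.choose k) * z ^ k) * ((-1 : ℂ) ^ j * (r.choose j)) *
      ((((4 * ((j : ℤ) - k) + 1 : ℤ) : ℂ) * s ^ (4 * ((j : ℤ) - k) + 1 - 1))
        / (4 * ((j : ℂ) - k) + 1))) s := by
    unfold ljG
    apply HasDerivAt.fun_sum
    intro k _
    apply HasDerivAt.fun_sum
    intro j _
    apply HasDerivAt.const_mul
    apply HasDerivAt.div_const
    exact hasDerivAt_zpow _ _ (Or.inl hs)
  convert h1 using 1
  have e : (z - s ^ 4) * (s ^ 4 - 1) / s ^ 4 = (-(z / s^4) + 1) * (-(s^4) + 1) := by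
    field_simp; ring
  rw [e, mul_pow, add_pow, add_pow, Finset.sum_mul_sum]
  apply Finset.sum_congr rfl
  intro k _
  apply Finset.sum_congr rfl
  intro j _
  have hne := lj_den_ne j k
  push_cast at hne
  push_cast
  rw [mul_div_assoc, mul_comm (4 * ((j : ℂ) - k) + 1), div_mul_cancel₀ _ hne]
  have : s ^ (4 * ((j : ℤ) - k) + 1 - 1) = (s^4)^j / (s^4)^k := by
    rw [show (4 * ((j : ℤ) - k) + 1 - 1) = ((4 * j : ℕ) : ℤ) - ((4 * k : ℕ) : ℤ) by push_cast; ring,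
      zpow_sub₀ hs, zpow_natCast, zpow_natCast, pow_mul, pow_mul]
  rw [this, neg_pow, neg_pow (s^4), div_pow]
  simp only [one_pow]
  ring

lemma ljG_one (r : ℕ) (z : ℂ) : ljG r z 1 = ljPA r z := by
  unfold ljG ljPA ljA ljS
  apply Finset.sum_congr rfl
  intro k _
  rw [Finset.mul_sum, Finset.sum_mul]
  apply Finset.sum_congr rfl
  intro j _
  rw [one_zpow]
  ring

lemma ljG_t (r : ℕ) (t : ℂ) (ht : t ≠ 0) : ljG r (t^4) t = t * ljPB r (t^4) := by
  unfold ljG ljPB ljA ljS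
  rw [Finset.sum_comm, Finset.mul_sum, ← Finset.sum_range_reflect]
  apply Finset.sum_congr rfl
  intro j hj
  rw [← Finset.sum_range_reflect, Finset.mul_sum, Finset.sum_mul, Finset.mul_sum]
  apply Finset.sum_congr rfl
  intro k hk
  have hj' : j ≤ r := by simp at hj; omega
  have hk' : k ≤ r := by simp at hk; omega
  rw [show r + 1 - 1 - j = r - j by omega, show r + 1 - 1 - k = r - k by omega,
    Nat.choose_symm hj', Nat.choose_symm hk']
  have e1 : ((r - j : ℕ) : ℤ) = (r:ℤ) - j := by omega
  have e2 : ((r - k : ℕ) : ℤ) = (r:ℤ) - k := by omega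
  have e3 : ((r - j : ℕ) : ℂ) = (r:ℂ) - j := by rw [Nat.cast_sub hj']
  have e4 : ((r - k : ℕ) : ℂ) = (r:ℂ) - k := by rw [Nat.cast_sub hk']
  have s1 : ∀ i, i ≤ r → (-1 : ℂ) ^ (r - i) = (-1)^r * (-1)^i := by
    intro i hi
    obtain ⟨m, rfl⟩ := Nat.exists_eq_add_of_le hi
    rw [Nat.add_sub_cancel_left, pow_add]
    have : (-1:ℂ)^i * (-1)^i = 1 := by rw [← mul_pow]; simp
    linear_combination (-(-1:ℂ)^m) * this
  have s2 : (-1:ℂ)^r * (-1)^r = 1 := by rw [← mul_pow]; simp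
  have p : (t^4)^(r-k) * t ^ (4 * (((r - j : ℕ) : ℤ) - ((r-k : ℕ) : ℤ)) + 1) = t * (t^4)^(r-j) := by
    rw [← pow_mul, ← pow_mul, ← zpow_natCast, ← zpow_natCast, ← zpow_add₀ ht, ← zpow_one_add₀ ht]
    congr 1
    push_cast
    ring
  rw [s1 j hj', s1 k hk']
  have d : (4 * (((r - j : ℕ) : ℂ) - ((r-k : ℕ) : ℂ)) + 1) = (4 * ((k:ℂ) - j) + 1) := by
    rw [e3, e4]; ring
  rw [d]
  calc _ = ((-1:ℂ)^r * (-1)^r) * ((-1)^j * (-1)^k * (r.choose j) * (r.choose k)) *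
        ((t^4)^(r-k) * t ^ (4 * (((r - j : ℕ) : ℤ) - ((r-k : ℕ) : ℤ)) + 1))
          / (4 * ((k:ℂ) - j) + 1) := by ring
    _ = _ := by rw [s2, p]; ring

lemma ljE_bound (r : ℕ) (t : ℂ) (M : ℝ)
    (h : ∀ s ∈ segment ℝ 1 t, s ≠ 0 ∧ ‖(t^4 - s^4) * (s^4 - 1) / s^4‖ ≤ M) :
    ‖ljPA r (t^4) - t * ljPB r (t^4)‖ ≤ M ^ r * ‖t - 1‖ := by
  have ht : t ≠ 0 := (h t (right_mem_segment ℝ 1 t)).1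
  rw [← ljG_one, ← ljG_t r t ht, norm_sub_rev]
  apply Convex.norm_image_sub_le_of_norm_hasDerivWithin_le (𝕜 := ℂ) (s := segment ℝ 1 t)
    (f' := fun s => ((t^4 - s ^ 4) * (s ^ 4 - 1) / s ^ 4) ^ r)
  · intro s hs
    exact (ljG_deriv r _ s (h s hs).1).hasDerivWithinAt
  · intro s hs
    rw [norm_pow]
    exact pow_le_pow_left₀ (norm_nonneg _) (h s hs).2 r
  · exact convex_segment 1 t
  · exact left_mem_segment ℝ 1 t
  · exact right_mem_segment ℝ 1 t

lemma ljE_real (r : ℕ) (t : ℝ) (h1 : 1 ≤ t) (h2 : t ≤ 2) :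
    ‖ljPA r ((t:ℂ)^4) - t * ljPB r ((t:ℂ)^4)‖ ≤ (1024 * (t-1)^2) ^ r * (t - 1) := by
  have := ljE_bound r (t:ℂ) (1024 * (t-1)^2) (by
    intro s hs
    obtain ⟨a, b, ha, hb, hab, rfl⟩ := hs
    have e : (a • (1:ℂ) + b • (t:ℂ)) = ((a + b * t : ℝ) : ℂ) := by
      simp
    rw [e]
    set x := a + b * t with hx
    have x1 : 1 ≤ x := by nlinarith
    have x2 : x ≤ t := by nlinarith
    refine ⟨by exact_mod_cast (by linarith : x ≠ 0), ?_⟩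
    have : ((t:ℂ)^4 - (x:ℂ)^4) * ((x:ℂ)^4 - 1) / (x:ℂ)^4 =
      (((t^4 - x^4) * (x^4 - 1) / x^4 : ℝ) : ℂ) := by push_cast; rfl
    rw [this, Complex.norm_real, Real.norm_eq_abs]
    have q : ∀ y : ℝ, 1 ≤ y → y ≤ 2 → ∀ w : ℝ, 1 ≤ w → w ≤ y → 0 ≤ y^4 - w^4 ∧ y^4 - w^4 ≤ 32 * (y - w) := by
      intro y hy1 hy2 w hw1 hw2
      have e : y^4 - w^4 = (y - w) * ((y + w) * (y^2 + w^2)) := by ring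
      have b1 : (y + w) * (y^2 + w^2) ≤ 4 * 8 := by
        apply mul_le_mul (by linarith) (by nlinarith) (by positivity) (by norm_num)
      have b0 : 0 ≤ (y + w) * (y^2 + w^2) := by apply mul_nonneg; linarith; positivity
      rw [e]
      constructor
      · exact mul_nonneg (by linarith) b0
      · nlinarith
    obtain ⟨a1, a2⟩ := q t h1 h2 x x1 x2
    obtain ⟨b1, b2⟩ := q x x1 (by linarith) 1 le_rfl x1
    have x4 : 1 ≤ x^4 := one_le_pow₀ x1
    rw [one_pow] at b1 b2
    rw [abs_of_nonneg (div_nonneg (mul_nonneg a1 b1) (by positivity))]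
    rw [div_le_iff₀ (by positivity)]
    calc (t^4 - x^4) * (x^4 - 1) ≤ (32 * (t - x)) * (32 * (x - 1)) :=
          mul_le_mul a2 b2 b1 (by linarith)
      _ ≤ (1024 * (t-1)^2) * 1 := by nlinarith
      _ ≤ _ := by apply mul_le_mul_of_nonneg_left x4; positivity)
  refine this.trans (le_of_eq ?_)
  congr 1
  rw [show ((t:ℂ) - 1) = ((t - 1 : ℝ) : ℂ) by push_cast; rfl, Complex.norm_real,
    Real.norm_eq_abs, abs_of_nonneg (by linarith)]

open Polynomial in
lemma lj_det (r : ℕ) (z : ℂ) (hz : z ≠ 1) :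
    ljPA r z * ljPB (r+1) z - ljPA (r+1) z * ljPB r z ≠ 0 := by
  let pA : ℕ → ℂ[X] := fun r => ∑ k ∈ Finset.range (r+1), C (ljA r k) * X ^ k
  let pB : ℕ → ℂ[X] := fun r => ∑ k ∈ Finset.range (r+1), C (ljA r k) * X ^ (r - k)
  have eA : ∀ r z, (pA r).eval z = ljPA r z := by
    intro r z; simp [pA, ljPA, eval_finsetSum]
  have eB : ∀ r z, (pB r).eval z = ljPB r z := by
    intro r z; simp [pB, ljPB, eval_finsetSum]
  have dA : ∀ r, (pA r).natDegree ≤ r := by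
    intro r
    apply natDegree_sum_le_of_forall_le
    intro k hk
    exact (natDegree_C_mul_X_pow_le _ _).trans (by simp at hk; omega)
  have dB : ∀ r, (pB r).natDegree ≤ r := by
    intro r
    apply natDegree_sum_le_of_forall_le
    intro k hk
    exact (natDegree_C_mul_X_pow_le _ _).trans (by omega)
  set D : ℂ[X] := pA r * pB (r+1) - pA (r+1) * pB r with hD
  have eD : ∀ z, D.eval z = ljPA r z * ljPB (r+1) z - ljPA (r+1) z * ljPB r z := by
    intro z; simp [hD, eA, eB]
  have dD : D.natDegree ≤ 2 * r + 1 := by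
    apply (natDegree_sub_le _ _).trans
    apply max_le
    · refine natDegree_mul_le.trans ?_
      have := dA r; have := dB (r+1); omega
    · refine natDegree_mul_le.trans ?_
      have := dA (r+1); have := dB r; omega
  have A0 : ∀ r, ljPA r 0 = ljA r 0 := by
    intro r
    unfold ljPA
    rw [Finset.sum_eq_single 0]
    · simp
    · intro b _ hb; simp [hb]
    · simp
  have B0 : ∀ r, ljPB r 0 = ljA r r := by
    intro r
    unfold ljPB
    rw [Finset.sum_eq_single r]
    · simp
    · intro b hb1 hb
      have : r - b ≠ 0 := by simp at hb1; omega
      simp [this]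
    · simp
  have C0 : ∀ r, (ljC r 0 : ℂ) = 2 ^ r * ljFF r 3 / r.factorial := by
    intro r
    unfold ljC
    rw [Nat.cast_mul, Nat.cast_div (ljFF_dvd _ _) (by exact_mod_cast Nat.factorial_ne_zero _)]
    simp [ljFF]
  have Cr : ∀ r, (ljC r r : ℂ) = 2 ^ r * ljFF r 5 / r.factorial := by
    intro r
    unfold ljC
    rw [Nat.cast_mul, Nat.cast_div (ljFF_dvd r _) (by exact_mod_cast Nat.factorial_ne_zero _)]
    simp [ljFF]
  have D0 : D ≠ 0 := by
    intro h
    have h0 : D.eval 0 = 0 := by rw [h]; simp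
    rw [eD, A0, A0, B0, B0] at h0
    have h1 : (ljC r 0 : ℂ) * ljC (r+1) (r+1) - ljC (r+1) 0 * ljC r r = 0 := by
      rw [← ljK_mul _ _ (Nat.zero_le _), ← ljK_mul _ _ le_rfl, ← ljK_mul _ _ (Nat.zero_le _),
        ← ljK_mul _ _ le_rfl]
      linear_combination (ljK r : ℂ) * (ljK (r+1)) * h0
    rw [C0, C0, Cr, Cr, ljFF_add r 1 3, ljFF_add r 1 5, Nat.factorial_succ] at h1
    have g3 : (r.factorial : ℂ) ≠ 0 := by exact_mod_cast (Nat.factorial_ne_zero _)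
    have g1 : (ljFF r 3 : ℂ) ≠ 0 := by exact_mod_cast (ljFF_pos _ _ (by norm_num)).ne'
    have g2 : (ljFF r 5 : ℂ) ≠ 0 := by exact_mod_cast (ljFF_pos _ _ (by norm_num)).ne'
    have g4 : (r:ℂ) + 1 ≠ 0 := by exact_mod_cast (Nat.succ_ne_zero r)
    have f1 : ∀ c, ljFF 1 c = c := by intro c; simp [ljFF]
    rw [f1, f1] at h1
    push_cast at h1
    have h2 : (2:ℂ)^r * 2^(r+1) * ljFF r 3 * ljFF r 5 * 2 / (r.factorial ^ 2 * ((r:ℂ)+1)) = 0 := by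
      rw [← h1]; field_simp; ring
    have : (2:ℂ)^r * 2^(r+1) * ljFF r 3 * ljFF r 5 * 2 / (r.factorial ^ 2 * ((r:ℂ)+1)) ≠ 0 := by
      apply div_ne_zero
      · simp [g1, g2]
      · simp [g3, g4]
    exact this h2
  obtain ⟨q, hq, hnd⟩ := exists_eq_pow_rootMultiplicity_mul_and_not_dvd D D0 1
  set j := D.rootMultiplicity 1
  have q1 : q.eval 1 ≠ 0 := by
    intro h; exact hnd (dvd_iff_isRoot.2 h)
  have hj : 2 * r + 1 ≤ j := by
    by_contra hlt
    push Not at hlt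
    let H : ℝ → ℝ := fun t => 1024^r * ‖(pB (r+1)).eval ((t:ℂ)^4)‖
      + 1024^(r+1) * (t-1)^2 * ‖(pB r).eval ((t:ℂ)^4)‖
    have bound : ∀ t : ℝ, t ∈ Set.Ioo (1:ℝ) 2 → ‖q.eval ((t:ℂ)^4)‖ ≤ (t-1) * H t := by
      intro t ht
      have t0 : 0 < t - 1 := by linarith [ht.1]
      have E1 := ljE_real r t ht.1.le ht.2.le
      have E2 := ljE_real (r+1) t ht.1.le ht.2.le
      have e : D.eval ((t:ℂ)^4) = (ljPA r ((t:ℂ)^4) - t * ljPB r ((t:ℂ)^4)) * ljPB (r+1) ((t:ℂ)^4)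
        - (ljPA (r+1) ((t:ℂ)^4) - t * ljPB (r+1) ((t:ℂ)^4)) * ljPB r ((t:ℂ)^4) := by
        rw [eD]; ring
      have b1 : ‖D.eval ((t:ℂ)^4)‖ ≤ (t-1)^(2*r+1) * H t := by
        rw [e]
        refine (norm_sub_le _ _).trans ?_
        rw [norm_mul, norm_mul]
        refine (add_le_add (mul_le_mul_of_nonneg_right E1 (norm_nonneg _))
          (mul_le_mul_of_nonneg_right E2 (norm_nonneg _))).trans (le_of_eq ?_)
        simp only [H, eB]
        rw [mul_pow, mul_pow, ← pow_mul, ← pow_mul]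
        ring
      have b2 : ‖D.eval ((t:ℂ)^4)‖ = (t^4-1)^j * ‖q.eval ((t:ℂ)^4)‖ := by
        rw [hq, eval_mul, norm_mul]
        simp only [eval_pow, eval_sub, eval_X, eval_C, norm_pow]
        congr 2
        rw [show ((t:ℂ)^4 - 1) = ((t^4 - 1 : ℝ) : ℂ) by push_cast; rfl, Complex.norm_real,
          Real.norm_eq_abs, abs_of_nonneg]
        have : 1 ≤ t^4 := one_le_pow₀ ht.1.le
        linarith
      have b3 : (t-1)^j ≤ (t^4-1)^j := by
        apply pow_le_pow_left₀ t0.le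
        have : t ≤ t^4 := le_self_pow₀ ht.1.le (by norm_num)
        linarith
      have Hn : 0 ≤ H t := by simp only [H]; positivity
      have b4 : (t-1)^j * ‖q.eval ((t:ℂ)^4)‖ ≤ (t-1)^j * ((t-1) * H t) := by
        calc _ ≤ (t^4-1)^j * ‖q.eval ((t:ℂ)^4)‖ :=
              mul_le_mul_of_nonneg_right b3 (norm_nonneg _)
          _ ≤ (t-1)^(2*r+1) * H t := by rw [← b2]; exact b1
          _ ≤ (t-1)^(j+1) * H t := by
              apply mul_le_mul_of_nonneg_right _ Hn
              apply pow_le_pow_of_le_one t0.le (by linarith [ht.2]) (by omega)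
          _ = _ := by ring
      exact le_of_mul_le_mul_left b4 (by positivity)
    have c1 : Continuous (fun t : ℝ => ‖q.eval ((t:ℂ)^4)‖) := by fun_prop
    have c2 : Continuous (fun t : ℝ => (t-1) * H t) := by simp only [H]; fun_prop
    have l1 := (c1.tendsto 1).mono_left (nhdsWithin_le_nhds (s := Set.Ioi (1:ℝ)))
    have l2 := (c2.tendsto 1).mono_left (nhdsWithin_le_nhds (s := Set.Ioi (1:ℝ)))
    have := le_of_tendsto_of_tendsto l1 l2 (by
      filter_upwards [Ioo_mem_nhdsGT (show (1:ℝ) < 2 by norm_num)] with t ht using bound t ht)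
    simp at this
    exact q1 this
  have q0 : q ≠ 0 := by rintro rfl; simp at q1
  have hdeg : D.natDegree = j + q.natDegree := by
    conv_lhs => rw [hq]
    rw [natDegree_mul (pow_ne_zero _ (X_sub_C_ne_zero 1)) q0, natDegree_pow, natDegree_X_sub_C]
    ring
  have hqd : q.natDegree = 0 := by omega
  rw [← eD, hq, eq_C_of_natDegree_eq_zero hqd]
  rw [eq_C_of_natDegree_eq_zero hqd] at q1
  simp only [eval_C] at q1
  simp only [eval_mul, eval_pow, eval_sub, eval_X, eval_C]
  exact mul_ne_zero (pow_ne_zero _ (sub_ne_zero.2 hz)) q1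

lemma lj_rho : ∃ ρ : ℂ, ρ ^ 4 = Complex.I ∧ ‖ρ‖ = 1 ∧
    ‖ρ - (5 - 12 * Complex.I) / 13‖ ≤ 22 / 10000 := by
  have s2 : (√2)^2 = 2 := Real.sq_sqrt (by norm_num)
  have s2a : 1.41421 < √2 := Real.lt_sqrt_of_sq_lt (by norm_num)
  have s2b : √2 < 1.41422 := by rw [Real.sqrt_lt' (by norm_num)]; norm_num
  set a := √((2 - √2)/4) with ha
  set b := √((2 + √2)/4) with hb
  have a2 : a^2 = (2 - √2)/4 := Real.sq_sqrt (by linarith)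
  have b2 : b^2 = (2 + √2)/4 := Real.sq_sqrt (by linarith)
  have ab : a * b = √2 / 4 := by
    rw [ha, hb, ← Real.sqrt_mul (by linarith)]
    rw [show (2 - √2)/4 * ((2 + √2)/4) = (√2/4)^2 by nlinarith]
    exact Real.sqrt_sq (by positivity)
  have la : 0.38268 < a := Real.lt_sqrt_of_sq_lt (by norm_num; linarith)
  have ua : a < 0.38269 := by rw [ha, Real.sqrt_lt' (by norm_num)]; norm_num; linarith
  have lb : 0.92387 < b := Real.lt_sqrt_of_sq_lt (by norm_num; linarith)
  have ub : b < 0.92389 := by rw [hb, Real.sqrt_lt' (by norm_num)]; norm_num; linarith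
  have I2 : Complex.I ^ 2 = -1 := Complex.I_sq
  refine ⟨(a:ℂ) - b * Complex.I, ?_, ?_, ?_⟩
  · have e1 : ((a:ℂ) - b * Complex.I)^2 = ((a^2 - b^2 : ℝ) : ℂ) - 2 * ((a * b : ℝ) : ℂ) * Complex.I := by
      push_cast; linear_combination (b:ℂ)^2 * I2
    rw [show ((a:ℂ) - b * Complex.I)^4 = (((a:ℂ) - b * Complex.I)^2)^2 by ring, e1, a2, b2, ab]
    have s2c : ((√2 : ℝ) : ℂ)^2 = 2 := by exact_mod_cast s2
    push_cast
    linear_combination (((√2 : ℝ) : ℂ)^2/4) * I2 + (Complex.I/2) * s2c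
  · rw [← sq_eq_sq₀ (norm_nonneg _) (by norm_num), ← Complex.normSq_eq_norm_sq, Complex.normSq_apply]
    simp
    nlinarith
  · rw [← sq_le_sq₀ (norm_nonneg _) (by norm_num), ← Complex.normSq_eq_norm_sq, Complex.normSq_apply]
    simp
    norm_num at la ua lb ub ⊢
    nlinarith

lemma lj_min4 (a b c d P : ℝ) (ha : 0 ≤ a) (hb : 7/10 ≤ b) (hc : 7/10 ≤ c) (hd : 7/10 ≤ d)
    (h : a * b * c * d ≤ P) : a * (343/1000) ≤ P := by
  refine le_trans ?_ h
  have h1 : a * (7/10) ≤ a * b := mul_le_mul_of_nonneg_left hb ha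
  have h2 : a * (7/10) * (7/10) ≤ a * b * c := mul_le_mul h1 hc (by norm_num) (by nlinarith)
  have h3 : a * (7/10) * (7/10) * (7/10) ≤ a * b * c * d :=
    mul_le_mul h2 hd (by norm_num) (by nlinarith)
  linarith

lemma lj_root (ρ q : ℂ) (hq : ‖q‖ = 1) (P : ℝ) (h : ‖ρ^4 - q^4‖ ≤ P) :
    ∃ j : ℕ, ‖ρ - Complex.I ^ j * q‖ * (343/1000) ≤ P := by
  have I2 : Complex.I ^ 2 = -1 := Complex.I_sq
  have prod : ‖ρ - Complex.I ^ 0 * q‖ * ‖ρ - Complex.I ^ 1 * q‖ * ‖ρ - Complex.I ^ 2 * q‖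
      * ‖ρ - Complex.I ^ 3 * q‖ ≤ P := by
    rw [← norm_mul, ← norm_mul, ← norm_mul]
    convert h using 2
    rw [show Complex.I ^ 3 = - Complex.I by rw [pow_succ, I2]; ring, I2]
    linear_combination (-ρ^2 * q^2 + q^4) * I2
  have two : ∀ c : ℂ, 2 ≤ Complex.normSq c → ∀ x y : ℂ, x - y = c * q → ‖x‖ ≤ ‖y‖ → 7/10 ≤ ‖y‖ := by
    intro c hc x y hxy hle
    have : ‖c * q‖ ≤ ‖x‖ + ‖y‖ := by rw [← hxy]; exact norm_sub_le _ _
    rw [norm_mul, hq, mul_one] at this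
    rw [Complex.normSq_eq_norm_sq] at hc
    nlinarith [norm_nonneg c]
  have pair : ∀ i < 4, ∀ j < 4, i ≠ j → 2 ≤ Complex.normSq (Complex.I ^ j - Complex.I ^ i) := by
    have I3 : Complex.I ^ 3 = - Complex.I := by rw [pow_succ, I2]; ring
    intro i hi j hj hij
    interval_cases i <;> interval_cases j <;>
      first
      | exact absurd rfl hij
      | (simp only [pow_zero, pow_one, I2, I3, Complex.normSq_apply]; norm_num)
  have key : ∀ i < 4, ∀ j < 4, i ≠ j → ‖ρ - Complex.I ^ i * q‖ ≤ ‖ρ - Complex.I ^ j * q‖ →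
      7/10 ≤ ‖ρ - Complex.I ^ j * q‖ := by
    intro i hi j hj hij hle
    exact two _ (pair i hi j hj hij) _ _ (by ring) hle
  obtain ⟨i, hi, hmin⟩ := Finset.exists_min_image (Finset.range 4)
    (fun j => ‖ρ - Complex.I ^ j * q‖) ⟨0, by simp⟩
  have hi4 : i < 4 := by simpa using hi
  have hm : ∀ j < 4, i ≠ j → 7/10 ≤ ‖ρ - Complex.I ^ j * q‖ := fun j hj hij =>
    key i hi4 j hj hij (hmin j (by simpa using hj))
  refine ⟨i, ?_⟩
  interval_cases i
  · exact lj_min4 _ _ _ _ _ (norm_nonneg _) (hm 1 (by norm_num) (by norm_num))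
      (hm 2 (by norm_num) (by norm_num)) (hm 3 (by norm_num) (by norm_num)) prod
  · exact lj_min4 _ _ _ _ _ (norm_nonneg _) (hm 0 (by norm_num) (by norm_num))
      (hm 2 (by norm_num) (by norm_num)) (hm 3 (by norm_num) (by norm_num)) (by linarith)
  · exact lj_min4 _ _ _ _ _ (norm_nonneg _) (hm 0 (by norm_num) (by norm_num))
      (hm 1 (by norm_num) (by norm_num)) (hm 3 (by norm_num) (by norm_num)) (by linarith)
  · exact lj_min4 _ _ _ _ _ (norm_nonneg _) (hm 0 (by norm_num) (by norm_num))
      (hm 1 (by norm_num) (by norm_num)) (hm 2 (by norm_num) (by norm_num)) (by linarith)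

lemma lj_E_num (r : ℕ) (t : ℂ) (ht : ‖t‖ = 1) (hd : ‖t - 1‖ ≤ 22/10000) :
    ‖ljPA r (t^4) - t * ljPB r (t^4)‖ ≤ (1/50000) ^ r * (22/10000) := by
  refine (ljE_bound r t (1/50000) ?_).trans (mul_le_mul_of_nonneg_left hd (by positivity))
  intro s hs
  have hs1 : ‖s‖ ≤ 1 := by
    have := (convex_closedBall (0:ℂ) 1).segment_subset (x := 1) (y := t) (by simp) (by simp [ht]) hs
    simpa using this
  obtain ⟨a, b, ha, hb, hab, rfl⟩ := hs
  set s := a • (1:ℂ) + b • t with hsd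
  have e1 : s - 1 = b * (t - 1) := by
    have : (a:ℂ) = 1 - b := by rw [← Complex.ofReal_one, ← Complex.ofReal_sub]; congr 1; linarith
    simp only [hsd, Complex.real_smul, this]; ring
  have e2 : t - s = a * (t - 1) := by
    have : (b:ℂ) = 1 - a := by rw [← Complex.ofReal_one, ← Complex.ofReal_sub]; congr 1; linarith
    simp only [hsd, Complex.real_smul, this]; ring
  have n1 : ‖s - 1‖ ≤ b * (22/10000) := by
    rw [e1, norm_mul, Complex.norm_real, Real.norm_eq_abs, abs_of_nonneg hb]
    exact mul_le_mul_of_nonneg_left hd hb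
  have n2 : ‖t - s‖ ≤ a * (22/10000) := by
    rw [e2, norm_mul, Complex.norm_real, Real.norm_eq_abs, abs_of_nonneg ha]
    exact mul_le_mul_of_nonneg_left hd ha
  have low : 997/1000 ≤ ‖s‖ := by
    have : ‖(1:ℂ)‖ ≤ ‖s‖ + ‖s - 1‖ := by
      have := norm_sub_le s (s - 1)
      simpa using this
    rw [norm_one] at this
    nlinarith
  have low4 : 98/100 ≤ ‖s‖^4 := by
    calc (98/100 : ℝ) ≤ (997/1000)^4 := by norm_num
      _ ≤ _ := pow_le_pow_left₀ (by norm_num) low 4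
  refine ⟨by intro h; rw [h, norm_zero] at low; norm_num at low, ?_⟩
  have f : ∀ x y : ℂ, ‖x‖ ≤ 1 → ‖y‖ ≤ 1 → ‖x^4 - y^4‖ ≤ ‖x - y‖ * 4 := by
    intro x y hx hy
    rw [show x^4 - y^4 = (x - y) * ((x + y) * (x^2 + y^2)) by ring, norm_mul, norm_mul]
    apply mul_le_mul_of_nonneg_left _ (norm_nonneg _)
    have g1 : ‖x + y‖ ≤ 2 := (norm_add_le _ _).trans (by linarith)
    have g2 : ‖x^2 + y^2‖ ≤ 2 := by
      refine (norm_add_le _ _).trans ?_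
      rw [norm_pow, norm_pow]
      nlinarith [norm_nonneg x, norm_nonneg y]
    nlinarith [norm_nonneg (x+y), norm_nonneg (x^2+y^2)]
  have m1 := f t s ht.le hs1
  have m2 := f s 1 hs1 (by simp)
  rw [one_pow] at m2
  rw [norm_div, norm_mul, norm_pow, div_le_iff₀ (by linarith)]
  calc ‖t^4 - s^4‖ * ‖s^4 - 1‖ ≤ (a * (22/10000) * 4) * (b * (22/10000) * 4) := by
        apply mul_le_mul (by linarith) (by linarith) (norm_nonneg _) (by positivity)
    _ ≤ 1/50000 * (98/100) := by
        have : a * b ≤ 1/4 := by nlinarith [sq_nonneg (a - b)]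
        nlinarith
    _ ≤ _ := by linarith

lemma lj_gauss_norm (N : GaussianInt) (h : N ≠ 0) : 1 ≤ ‖(GaussianInt.toComplex N)‖ := by
  have h1 : (1:ℤ) ≤ N.norm := by
    have := GaussianInt.norm_pos.2 h
    omega
  have h2 : ((N.norm : ℤ) : ℝ) = ‖(GaussianInt.toComplex N)‖^2 := by
    rw [GaussianInt.intCast_real_norm, Complex.normSq_eq_norm_sq]
  have h3 : (1:ℝ) ≤ ‖(GaussianInt.toComplex N)‖^2 := by rw [← h2]; exact_mod_cast h1
  nlinarith [norm_nonneg (GaussianInt.toComplex N)]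

/-- The Gaussian integer built from the approximants. -/
def ljN (r : ℕ) (u v P Q : GaussianInt) : GaussianInt :=
  ∑ k ∈ Finset.range (r+1), (ljC r k : GaussianInt) * (u^k * v^(r-k) * P - u^(r-k) * v^k * Q)

lemma ljN_cast (r : ℕ) (u v P Q : GaussianInt) (z : ℂ)
    (hz : GaussianInt.toComplex u = z * GaussianInt.toComplex v) :
    GaussianInt.toComplex (ljN r u v P Q) = (GaussianInt.toComplex v)^r * ljK r *
      (ljPA r z * GaussianInt.toComplex P - ljPB r z * GaussianInt.toComplex Q) := by
  unfold ljN ljPA ljPB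
  rw [map_sum, Finset.sum_mul, Finset.sum_mul, ← Finset.sum_sub_distrib, Finset.mul_sum]
  apply Finset.sum_congr rfl
  intro k hk
  have hk' : k ≤ r := by simp at hk; omega
  simp only [map_mul, map_sub, map_pow, map_natCast]
  rw [← ljK_mul r k hk', hz, mul_pow, mul_pow]
  have e : (GaussianInt.toComplex v)^r = (GaussianInt.toComplex v)^k * (GaussianInt.toComplex v)^(r-k) := by
    rw [← pow_add]; congr 1; omega
  rw [e]
  ring

lemma ljKB (r : ℕ) (z : ℂ) (hz : ‖z‖ = 1) : ljK r * ‖ljPB r z‖ ≤ 2 * 32 ^ r := by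
  have : ljK r * ‖ljPB r z‖ = ‖(ljK r : ℂ) * ljPB r z‖ := by
    rw [norm_mul, Complex.norm_real, Real.norm_eq_abs, abs_of_pos (ljK_pos r)]
  rw [this]
  unfold ljPB
  rw [Finset.mul_sum]
  refine (norm_sum_le _ _).trans ?_
  have : ∀ k ∈ Finset.range (r+1), ‖(ljK r : ℂ) * (ljA r k * z^(r-k))‖ = (ljC r k : ℝ) := by
    intro k hk
    rw [← mul_assoc, ljK_mul r k (by simp at hk; omega), norm_mul, norm_pow, hz, one_pow, mul_one]
    simp
  rw [Finset.sum_congr rfl this]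
  exact_mod_cast ljC_sum r

lemma lj_thue (U : GaussianInt)
    (hU : ‖(GaussianInt.toComplex U)^4 + Complex.I * (starRingEnd ℂ (GaussianInt.toComplex U))^4‖ ≤ 3/2) :
    ‖GaussianInt.toComplex U‖ < 36 ^ 6 := by
  by_contra hbig
  push Not at hbig
  set x := GaussianInt.toComplex U with hx
  set X := ‖x‖ with hX
  have I2 : Complex.I ^ 2 = -1 := Complex.I_sq
  have X0 : 0 < X := lt_of_lt_of_le (by norm_num) hbig
  have x0 : x ≠ 0 := norm_pos_iff.1 X0
  obtain ⟨ρ, hρ4, hρ1, hρd⟩ := lj_rho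
  set q := (starRingEnd ℂ x) / x with hq
  have q1 : ‖q‖ = 1 := by rw [hq, norm_div, RCLike.norm_conj, div_self X0.ne']
  have qx : q * x = starRingEnd ℂ x := div_mul_cancel₀ _ x0
  have hroot : ‖ρ^4 - q^4‖ ≤ (3/2) / X^4 := by
    rw [hρ4, le_div_iff₀ (by positivity), hX, ← norm_pow, ← norm_mul]
    refine le_trans (le_of_eq ?_) hU
    rw [← qx, show (Complex.I - q^4) * x^4 = Complex.I * (x^4 + Complex.I * (q*x)^4) by
      linear_combination (-q^4*x^4) * I2, norm_mul, Complex.norm_I, one_mul]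
  obtain ⟨j, hj⟩ := lj_root ρ q q1 _ hroot
  have hd : ‖ρ - Complex.I ^ j * q‖ ≤ 5 / X^4 := by
    have : (3/2)/X^4 = (5 / X^4) * (3/10) := by ring
    have h5 : 0 ≤ 5/X^4 := by positivity
    nlinarith
  -- data
  let w : GaussianInt := ⟨3, 2⟩
  let wb : GaussianInt := ⟨3, -2⟩
  let ii : GaussianInt := ⟨0, 1⟩
  have cw : GaussianInt.toComplex w = 3 + 2 * Complex.I := by
    simp [w, GaussianInt.toComplex_def]
  have cwb : GaussianInt.toComplex wb = 3 - 2 * Complex.I := by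
    simp [wb, GaussianInt.toComplex_def]; ring
  have cii : GaussianInt.toComplex ii = Complex.I := by
    simp [ii, GaussianInt.toComplex_def]
  have cst : GaussianInt.toComplex (star U) = q * x := by
    rw [qx, GaussianInt.toComplex_star]
  set u := w^4
  set v := -ii * wb^4
  set P := wb * U
  set Q := ii^j * (w * star U)
  set t : ℂ := ρ * ((5 + 12 * Complex.I)/13) with ht
  have nw : ‖(3 + 2 * Complex.I : ℂ)‖^2 = 13 := by
    rw [← Complex.normSq_eq_norm_sq, Complex.normSq_apply]; norm_num
  have nwb : ‖(3 - 2 * Complex.I : ℂ)‖^2 = 13 := by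
    rw [← Complex.normSq_eq_norm_sq, Complex.normSq_apply]; norm_num
  have nw5 : ‖((5 + 12 * Complex.I)/13 : ℂ)‖ = 1 := by
    rw [← sq_eq_sq₀ (norm_nonneg _) (by norm_num), ← Complex.normSq_eq_norm_sq, Complex.normSq_apply]
    norm_num
  have nw' : ‖(3 + 2 * Complex.I : ℂ)‖ ≤ 37/10 := by nlinarith [norm_nonneg (3 + 2 * Complex.I : ℂ)]
  have nwb' : ‖(3 - 2 * Complex.I : ℂ)‖ ≤ 37/10 := by nlinarith [norm_nonneg (3 - 2 * Complex.I : ℂ)]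
  have wb0 : (3 - 2 * Complex.I : ℂ) ≠ 0 := by
    intro h; rw [h] at nwb; norm_num at nwb
  have t1 : ‖t‖ = 1 := by rw [ht, norm_mul, hρ1, nw5, one_mul]
  have td : ‖t - 1‖ ≤ 22/10000 := by
    have : t - 1 = (ρ - (5 - 12 * Complex.I)/13) * ((5 + 12 * Complex.I)/13) := by
      rw [ht]; linear_combination (-144/169) * I2
    rw [this, norm_mul, nw5, mul_one]; exact hρd
  have tw : t * (3 - 2 * Complex.I) = ρ * (3 + 2 * Complex.I) := by
    rw [ht]; linear_combination (-24/13 * ρ) * I2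
  have huv : GaussianInt.toComplex u = t^4 * GaussianInt.toComplex v := by
    simp only [u, v, map_pow, map_mul, map_neg, cw, cwb, cii]
    have : t^4 * (-Complex.I * (3 - 2 * Complex.I)^4) = -Complex.I * (t * (3 - 2 * Complex.I))^4 := by
      ring
    rw [this, tw, mul_pow, hρ4]
    linear_combination (3 + 2 * Complex.I)^4 * I2
  have nv : ‖GaussianInt.toComplex v‖ = 169 := by
    simp only [v, map_pow, map_mul, map_neg, cwb, cii]
    rw [norm_mul, norm_neg, Complex.norm_I, norm_pow,
      show ‖(3 - 2 * Complex.I : ℂ)‖^4 = (‖(3 - 2 * Complex.I : ℂ)‖^2)^2 by ring, nwb]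
    norm_num
  have cP : GaussianInt.toComplex P = (3 - 2 * Complex.I) * x := by
    simp only [P, map_mul, cwb, hx]
  have cQ : GaussianInt.toComplex Q = Complex.I^j * ((3 + 2 * Complex.I) * (q * x)) := by
    simp only [Q, map_mul, map_pow, cw, cii, cst]
  have hcast := fun r => ljN_cast r u v P Q (t^4) huv
  -- nonvanishing
  have z1 : t^4 ≠ 1 := by
    intro h
    have : u = v := by
      rw [h, one_mul] at huv
      exact GaussianInt.toComplex_injective huv
    revert this
    decide
  have nonzero : ∀ r, ljN r u v P Q ≠ 0 ∨ ljN (r+1) u v P Q ≠ 0 := by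
    intro r
    by_contra hcon
    push Not at hcon
    have aux : ∀ r, ljN r u v P Q = 0 →
        ljPA r (t^4) * GaussianInt.toComplex P - ljPB r (t^4) * GaussianInt.toComplex Q = 0 := by
      intro r h
      have h1 := hcast r
      rw [h, map_zero] at h1
      have v0 : GaussianInt.toComplex v ≠ 0 := by
        intro h; rw [h] at nv; norm_num at nv
      have k0 : (ljK r : ℂ) ≠ 0 := by exact_mod_cast (ljK_pos r).ne'
      exact (mul_eq_zero.1 h1.symm).resolve_left (mul_ne_zero (pow_ne_zero _ v0) k0)
    have a1 := aux r hcon.1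
    have a2 := aux (r+1) hcon.2
    have P0 : GaussianInt.toComplex P ≠ 0 := by rw [cP]; exact mul_ne_zero wb0 x0
    apply lj_det r (t^4) z1
    apply mul_right_cancel₀ P0
    linear_combination (ljPB (r+1) (t^4)) * a1 - (ljPB r (t^4)) * a2
  -- upper bound
  have upper : ∀ r, ‖GaussianInt.toComplex (ljN r u v P Q)‖ ≤
      (37/10) * (22/10000) * X * (1/36)^r + 37 * 5408^r / X^3 := by
    intro r
    rw [hcast r]
    have e : ljPA r (t^4) * GaussianInt.toComplex P - ljPB r (t^4) * GaussianInt.toComplex Q =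
      (ljPA r (t^4) - t * ljPB r (t^4)) * ((3 - 2 * Complex.I) * x)
        + ljPB r (t^4) * ((ρ - Complex.I^j * q) * ((3 + 2 * Complex.I) * x)) := by
      rw [cP, cQ]; linear_combination ljPB r (t^4) * x * tw
    rw [e, norm_mul, norm_mul, norm_pow, nv, Complex.norm_real, Real.norm_eq_abs,
      abs_of_pos (ljK_pos r)]
    have b1 := lj_E_num r t t1 td
    have b2 := ljKB r (t^4) (by rw [norm_pow, t1, one_pow])
    have b3 := ljK_le r
    have kp := ljK_pos r
    have c1 : ljK r * ‖(ljPA r (t^4) - t * ljPB r (t^4)) * ((3 - 2 * Complex.I) * x)‖ ≤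
        8^r * ((1/50000)^r * (22/10000) * (37/10 * X)) := by
      rw [norm_mul, norm_mul]
      gcongr
    have c2 : ljK r * ‖ljPB r (t^4) * ((ρ - Complex.I^j * q) * ((3 + 2 * Complex.I) * x))‖ ≤
        2 * 32^r * (5/X^4 * (37/10 * X)) := by
      rw [norm_mul, norm_mul, norm_mul, ← mul_assoc]
      gcongr
    calc (169:ℝ)^r * ljK r * ‖(ljPA r (t^4) - t * ljPB r (t^4)) * ((3 - 2 * Complex.I) * x)
        + ljPB r (t^4) * ((ρ - Complex.I^j * q) * ((3 + 2 * Complex.I) * x))‖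
        ≤ (169:ℝ)^r * ljK r * (‖(ljPA r (t^4) - t * ljPB r (t^4)) * ((3 - 2 * Complex.I) * x)‖
        + ‖ljPB r (t^4) * ((ρ - Complex.I^j * q) * ((3 + 2 * Complex.I) * x))‖) := by
          gcongr
          exact norm_add_le _ _
      _ = 169^r * (ljK r * ‖(ljPA r (t^4) - t * ljPB r (t^4)) * ((3 - 2 * Complex.I) * x)‖
        + ljK r * ‖ljPB r (t^4) * ((ρ - Complex.I^j * q) * ((3 + 2 * Complex.I) * x))‖) := by ring
      _ ≤ 169^r * (8^r * ((1/50000)^r * (22/10000) * (37/10 * X))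
          + 2 * 32^r * (5/X^4 * (37/10 * X))) := by gcongr
      _ = (37/10) * (22/10000) * X * (169 * 8 * (1/50000))^r + 37 * (169 * 32)^r / X^3 := by
          rw [mul_pow, mul_pow, mul_pow]; field_simp; ring
      _ ≤ _ := by
          have : (169 * 8 * (1/50000) : ℝ) ≤ 1/36 := by norm_num
          have : (169 * 32 : ℝ) = 5408 := by norm_num
          rw [this]
          gcongr
  obtain ⟨r, hr1, hr2⟩ := exists_nat_pow_near (x := X) (y := 36)
    (le_trans (by norm_num) hbig) (by norm_num)
  have r6 : 6 ≤ r := by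
    have : (36:ℝ)^6 < 36^(r+1) := lt_of_le_of_lt hbig hr2
    have := (pow_lt_pow_iff_right₀ (by norm_num : (1:ℝ) < 36)).1 this
    omega
  have small1 : ∀ s, r ≤ s → X * (1/36 : ℝ)^s ≤ 36 := by
    intro s hs
    calc X * (1/36 : ℝ)^s ≤ 36^(r+1) * (1/36)^r := by
          apply mul_le_mul hr2.le _ (by positivity) (by positivity)
          exact pow_le_pow_of_le_one (by norm_num) (by norm_num) hs
      _ = 36 := by rw [pow_succ, one_div, inv_pow]; field_simp
  have small2 : ∀ s, s ≤ r + 1 → 37 * (5408:ℝ)^s / X^3 ≤ 1/2 := by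
    intro s hs
    rw [div_le_iff₀ (by positivity)]
    obtain ⟨m, rfl⟩ := Nat.exists_eq_add_of_le r6
    calc 37 * (5408:ℝ)^s ≤ 37 * 5408^(6 + m + 1) := by
          gcongr; norm_num
      _ = (37 * 5408^7) * 5408^m := by ring
      _ ≤ (1/2 * (36^6)^3) * (36^3)^m := by
          exact mul_le_mul (by norm_num) (pow_le_pow_left₀ (by norm_num) (by norm_num) m)
            (by positivity) (by positivity)
      _ = 1/2 * (36^(6+m))^3 := by
          rw [pow_add, mul_pow, ← pow_mul (36:ℝ) m 3, ← pow_mul (36:ℝ) 3 m, mul_comm 3 m]; ring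
      _ ≤ 1/2 * X^3 := by gcongr
  have fin : ∀ s, r ≤ s → s ≤ r + 1 → ljN s u v P Q ≠ 0 → False := by
    intro s h1 h2 h3
    have l := lj_gauss_norm _ h3
    have up := upper s
    have m1 := small1 s h1
    have m2 := small2 s h2
    have : (37/10 : ℝ) * (22/10000) * X * (1/36)^s = (37/10 : ℝ) * (22/10000) * (X * (1/36)^s) := by
      ring
    rw [this] at up
    linarith
  rcases nonzero r with h | h
  · exact fin r le_rfl (by omega) h
  · exact fin (r+1) (by omega) le_rfl h

lemma lj_reduce (y1 y2 : ℕ) (h : y1 ^ 2 + 1 = 2 * y2 ^ 4) :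
    ∃ U : GaussianInt, U.norm = y2 ∧ ((U^4).re + (U^4).im = 1 ∨ (U^4).re + (U^4).im = -1) := by
  have hodd : Odd y1 := by
    by_contra hc
    rw [Nat.not_odd_iff_even] at hc
    obtain ⟨a, rfl⟩ := hc
    have : (a + a)^2 = 2 * (2 * a^2) := by ring
    omega
  obtain ⟨a, rfl⟩ := hodd
  have h1 : ((a:ℤ) + 1)^2 + (a:ℤ)^2 = (y2:ℤ)^4 := by
    have : ((2 * a + 1 : ℤ))^2 + 1 = 2 * (y2:ℤ)^4 := by exact_mod_cast h
    linarith
  set γ : GaussianInt := ⟨a + 1, -a⟩ with hγ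
  have hγn : γ.norm = (y2:ℤ)^4 := by
    rw [← h1, hγ, Zsqrtd.norm_def]; ring
  have hmul : γ * star γ = ((y2:ℕ) : GaussianInt)^4 := by
    have : ((y2:ℕ) : GaussianInt)^4 = (((y2:ℤ)^4 : ℤ) : GaussianInt) := by push_cast; rfl
    rw [this, ← hγn]
    exact (Zsqrtd.norm_eq_mul_conj γ).symm
  have hcop : IsCoprime γ (star γ) := by
    refine ⟨star γ - ((a:ℤ)^2 + a : ℤ) * ⟨1, -1⟩, -(((a:ℤ)^2 + a : ℤ) * ⟨1, 1⟩), ?_⟩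
    ext
    · simp [hγ, sq]; ring
    · simp [hγ, sq]; ring
  obtain ⟨d, e, hd⟩ := exists_associated_pow_of_mul_eq_pow' hcop hmul
  have he1 : ((e : GaussianInt)).norm = 1 := by
    have := (Zsqrtd.norm_eq_one_iff' (by norm_num : (-1:ℤ) ≤ 0) (e : GaussianInt)).2 e.isUnit
    exact this
  have hdn : d.norm = y2 := by
    have h2 : d.norm^4 = (y2:ℤ)^4 := by
      rw [← hγn, ← hd, Zsqrtd.norm_mul, he1, mul_one]
      have : ∀ n, (d^n).norm = d.norm^n := fun n => map_pow Zsqrtd.normMonoidHom d n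
      rw [this]
    exact (pow_left_inj₀ (GaussianInt.norm_nonneg d) (by positivity) (by norm_num)).1 h2
  have hs : γ.re + γ.im = 1 := by simp [hγ]
  rw [← hd] at hs
  simp only [Zsqrtd.re_mul, Zsqrtd.im_mul] at hs
  rw [Zsqrtd.norm_def] at he1
  set er := (e : GaussianInt).re
  set ei := (e : GaussianInt).im
  have hstar : ((star d)^4).re = (d^4).re ∧ ((star d)^4).im = -(d^4).im := by
    have hst : ∀ V : GaussianInt, (star V).re = V.re ∧ (star V).im = -V.im :=
      fun V => ⟨rfl, rfl⟩
    rw [← star_pow]; exact hst _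
  have hcase : (er = 0 ∧ (ei = 1 ∨ ei = -1)) ∨ (ei = 0 ∧ (er = 1 ∨ er = -1)) := by
    have he2 : er^2 + ei^2 = 1 := by linear_combination he1
    have a1 : er ≤ 1 := by nlinarith [sq_nonneg er, sq_nonneg ei]
    have a2 : -1 ≤ er := by nlinarith [sq_nonneg er, sq_nonneg ei]
    have b1 : ei ≤ 1 := by nlinarith [sq_nonneg er, sq_nonneg ei]
    have b2 : -1 ≤ ei := by nlinarith [sq_nonneg er, sq_nonneg ei]
    clear_value er ei
    clear hs he1
    interval_cases er <;> interval_cases ei <;> simp_all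
  rcases hcase with ⟨h0, h1 | h1⟩ | ⟨h0, h1 | h1⟩
  · refine ⟨star d, by rw [Zsqrtd.norm_conj, hdn], Or.inl ?_⟩
    rw [hstar.1, hstar.2]; rw [h0, h1] at hs; linarith
  · refine ⟨star d, by rw [Zsqrtd.norm_conj, hdn], Or.inr ?_⟩
    rw [hstar.1, hstar.2]; rw [h0, h1] at hs; linarith
  · refine ⟨d, hdn, Or.inl ?_⟩
    rw [h0, h1] at hs; linarith
  · refine ⟨d, hdn, Or.inr ?_⟩
    rw [h0, h1] at hs; linarith

lemma lj_bound (y1 y2 : ℕ) (h : y1 ^ 2 + 1 = 2 * y2 ^ 4) : y2 < 36 ^ 12 := by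
  obtain ⟨U, hn, hU⟩ := lj_reduce y1 y2 h
  have key := lj_thue U (by
    rw [← GaussianInt.toComplex_star, ← map_pow, ← map_pow, ← star_pow, GaussianInt.toComplex_star]
    set V := U^4
    have e : GaussianInt.toComplex V + Complex.I * (starRingEnd ℂ) (GaussianInt.toComplex V) =
        ((V.re + V.im : ℤ) : ℂ) * (1 + Complex.I) := by
      rw [GaussianInt.toComplex_def]
      simp
      linear_combination (-(V.im:ℂ)) * Complex.I_sq
    have n1 : ‖(1 + Complex.I : ℂ)‖ ≤ 3/2 := by
      rw [← sq_le_sq₀ (norm_nonneg _) (by norm_num), ← Complex.normSq_eq_norm_sq,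
        Complex.normSq_apply]
      norm_num
    rw [e, norm_mul]
    rcases hU with hU | hU <;> rw [hU] <;> simpa using n1)
  have h2 : ((U.norm : ℤ) : ℝ) = ‖(GaussianInt.toComplex U)‖^2 := by
    rw [GaussianInt.intCast_real_norm, Complex.normSq_eq_norm_sq]
  rw [hn] at h2
  have h3 : (y2 : ℝ) < 36 ^ 12 := by
    have : (y2 : ℝ) = ‖(GaussianInt.toComplex U)‖^2 := by rw [← h2]; simp
    rw [this]
    calc ‖(GaussianInt.toComplex U)‖^2 < (36^6)^2 :=
          pow_lt_pow_left₀ key (norm_nonneg _) (by norm_num)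
      _ = 36^12 := by norm_num
  exact_mod_cast h3

def ljPell : ℕ → ℕ × ℕ
  | 0 => (1, 1)
  | n + 1 => (3 * (ljPell n).1 + 4 * (ljPell n).2, 2 * (ljPell n).1 + 3 * (ljPell n).2)

lemma ljPell_ge (n : ℕ) : (ljPell n).2 ≤ (ljPell n).1 ∧ 5 ^ n ≤ (ljPell n).2 := by
  induction n with
  | zero => simp [ljPell]
  | succ n ih =>
    simp only [ljPell, pow_succ]
    omega

lemma ljPell_all (m : ℕ) : ∀ a : ℕ, a ^ 2 + 1 = 2 * m ^ 2 → ∃ n, ljPell n = (a, m) := by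
  induction m using Nat.strong_induction_on with
  | _ m ih =>
    intro a h
    rcases Nat.lt_or_ge m 2 with hm | hm
    · interval_cases m
      · omega
      · have : a = 1 := by nlinarith
        exact ⟨0, by simp [ljPell, this]⟩
    · have h1 : m < a := by nlinarith
      have h2 : 4 * m < 3 * a := by nlinarith
      have h3 : 2 * a < 3 * m := by nlinarith
      obtain ⟨a', ha'⟩ := Nat.exists_eq_add_of_lt h2
      obtain ⟨m', hm'⟩ := Nat.exists_eq_add_of_lt h3
      obtain ⟨n, hn⟩ := ih (m'+1) (by omega) (a'+1) (by
        zify at *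
        have e1 : (a':ℤ) + 1 = 3 * a - 4 * m := by linarith
        have e2 : (m':ℤ) + 1 = 3 * m - 2 * a := by linarith
        rw [e1, e2]
        linarith)
      refine ⟨n+1, ?_⟩
      simp only [ljPell, hn, Prod.mk.injEq]
      omega

lemma ljPell_check : ∀ n < 54, (ljPell n).2.sqrt * (ljPell n).2.sqrt = (ljPell n).2 → n = 0 ∨ n = 3 := by
  decide +kernel

theorem ljunggren (y1 y2 : ℕ) (h1 : 0 < y1) (h2 : 0 < y2) :
    y1 ^ 2 + 1 = 2 * y2 ^ 4 ↔ (y1, y2) = (1, 1) ∨ (y1, y2) = (239, 13) := by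
  constructor
  · intro h
    have hb := lj_bound y1 y2 h
    obtain ⟨n, hn⟩ := ljPell_all (y2^2) y1 (by rw [h]; ring)
    have hlt : n < 54 := by
      have g := (ljPell_ge n).2
      rw [hn] at g
      have g2 : y2^2 < 5^54 := by
        calc y2^2 < (36^12)^2 := Nat.pow_lt_pow_left hb (by norm_num)
          _ ≤ 5^54 := by norm_num
      exact (Nat.pow_lt_pow_iff_right (by norm_num : 1 < 5)).1 (lt_of_le_of_lt g g2)
    have hc := ljPell_check n hlt (by
      rw [hn]
      simp only [sq, Nat.sqrt_eq])
    rcases hc with rfl | rfl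
    · left
      simp [ljPell] at hn
      obtain ⟨rfl, h3⟩ := hn
      have : y2 = 1 := by nlinarith
      rw [this]
    · right
      simp [ljPell] at hn
      obtain ⟨rfl, h3⟩ := hn
      have : y2 = 13 := by nlinarith
      rw [this]
  · rintro (h | h) <;> (simp only [Prod.mk.injEq] at h; obtain ⟨rfl, rfl⟩ := h; norm_num)
end

section
/- If x is a positive integer satisfying x^2·(x+1) = 2·y^4 for some integer y > 1, then x = 57121 and y = 3107. -/
namespace Ljung
open Finset

/-- partial fractions -/
lemma pf (n : ℕ) : ∀ x : ℂ, (∀ m : ℕ, x + m ≠ 0) →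
    ∑ k ∈ range (n+1), (-1:ℂ)^k * (n.choose k) / (x + k) = n.factorial / ∏ m ∈ range (n+1), (x + m) := by
  induction n with
  | zero => intro x hx; simp
  | succ n ih =>
    intro x hx
    have hx1 : ∀ m : ℕ, (x+1) + m ≠ 0 := by
      intro m; have := hx (m+1); push_cast at this; intro h; apply this; rw [← h]; ring
    have e1 : ∑ k ∈ range (n+1+1), (-1:ℂ)^k * ((n+1).choose k) / (x + k)
        = ∑ k ∈ range (n+1), (-1:ℂ)^k * (n.choose k) / (x + k)
          - ∑ k ∈ range (n+1), (-1:ℂ)^k * (n.choose k) / (x + 1 + k) := by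
      rw [sum_range_succ', sum_range_succ' (fun k => (-1:ℂ)^k * (n.choose k) / (x + k))]
      have h2 : ∑ k ∈ range (n+1), (-1:ℂ)^(k+1) * ((n+1).choose (k+1) : ℕ) / (x + (k+1 : ℕ))
        = ∑ k ∈ range (n+1), ((-1:ℂ)^(k+1) * (n.choose (k+1) : ℕ) / (x + (k+1 : ℕ))
            - (-1:ℂ)^k * (n.choose k) / (x + 1 + k)) := by
        apply sum_congr rfl
        intro k _
        rw [Nat.choose_succ_succ]
        push_cast
        have := hx1 k
        have h3 : x + (k + 1) = x + 1 + k := by ring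
        rw [h3]
        field_simp
        ring
      rw [h2, sum_sub_distrib, sum_range_succ]
      simp
      ring
    rw [e1, ih x hx, ih (x+1) hx1]
    have a1 : ∏ m ∈ range (n+1+1), (x + m) = (∏ m ∈ range (n+1), (x+m)) * (x + (n+1)) := by
      rw [prod_range_succ]; push_cast; rfl
    have a2 : ∏ m ∈ range (n+1+1), (x + m) = (∏ m ∈ range (n+1), (x+1+m)) * x := by
      rw [prod_range_succ']; push_cast
      congr 1
      · apply prod_congr rfl; intros; ring
      · ring
    have b1 : ∏ m ∈ range (n+1), (x+m) ≠ 0 := prod_ne_zero_iff.2 (fun m _ => hx m)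
    have b2 : ∏ m ∈ range (n+1), (x+1+m) ≠ 0 := prod_ne_zero_iff.2 (fun m _ => hx1 m)
    have b3 := hx (n+1)
    push_cast at b3
    have b4 : x ≠ 0 := by simpa using hx 0
    rw [a1, Nat.factorial_succ]
    rw [a1] at a2
    push_cast
    rw [div_sub_div _ _ b1 b2, div_eq_div_iff (by positivity) (by positivity)]
    linear_combination (n.factorial : ℂ) * (∏ m ∈ range (n+1), (x+m)) * (- a2)

lemma slit {z : ℂ} (hz : ‖z-1‖ < 1) {t : ℝ} (ht : t ∈ Set.Icc (0:ℝ) 1) :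
    (1 + t*(z-1) : ℂ) ∈ Complex.slitPlane := by
  apply Complex.mem_slitPlane_of_norm_lt_one
  rw [norm_mul, Complex.norm_real, Real.norm_eq_abs, abs_of_nonneg ht.1]
  nlinarith [ht.2, norm_nonneg (z-1)]

lemma int1 {z : ℂ} (hz : ‖z-1‖ < 1) (e : ℂ) (he : e + 1 ≠ 0) :
    ∫ t in (0:ℝ)..1, (z-1)*(1+t*(z-1))^e = (z^(e+1)-1)/(e+1) := by
  have key : ∀ t ∈ Set.uIcc (0:ℝ) 1,
      HasDerivAt (fun t : ℝ => ((1 + t*(z-1) : ℂ)^(e+1))/(e+1)) ((z-1)*(1+t*(z-1))^e) t := by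
    intro t ht
    rw [Set.uIcc_of_le zero_le_one] at ht
    have h1 : HasDerivAt (fun t : ℝ => (1 + t*(z-1) : ℂ)) (z-1) t := by
      have := ((Complex.ofRealCLM.hasDerivAt (x := t)).mul_const (z-1)).const_add 1
      simpa using this
    have h0 : HasDerivAt (fun w : ℂ => w^(e+1)) ((e+1) * (1 + t*(z-1) : ℂ)^(e+1-1) * 1) (1 + t*(z-1) : ℂ) :=
      (hasDerivAt_id _).cpow_const (slit hz ht)
    have h2 := (HasDerivAt.scomp t h0 h1).div_const (e+1)
    refine h2.congr_deriv ?_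
    rw [smul_eq_mul, add_sub_cancel_right]
    field_simp
  rw [intervalIntegral.integral_eq_sub_of_hasDerivAt key]
  · simp; ring
  · apply ContinuousOn.intervalIntegrable
    rw [Set.uIcc_of_le zero_le_one]
    intro t ht
    apply ContinuousAt.continuousWithinAt
    have := slit hz ht
    apply ContinuousAt.mul continuousAt_const
    exact ContinuousAt.cpow (by fun_prop) continuousAt_const this


/-- `q r c = 8^r * binom`-like integers. -/
def q (r c : ℕ) : ℕ := 2^r * (∏ i ∈ range r, (c + 4*i)) / r.factorial

lemma fact_dvd (r c : ℕ) : r.factorial ∣ 2^r * ∏ i ∈ range r, (c + 4*i) := by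
  obtain ⟨v, m, hm, hvm⟩ := Nat.exists_eq_two_pow_mul_odd (Nat.factorial_ne_zero r)
  have hv : v ≤ r := by
    have h1 := sub_one_mul_padicValNat_factorial (p := 2) r
    have h2 : padicValNat 2 r.factorial = v := by
      rw [hvm, padicValNat.mul (by positivity) (by rintro rfl; simp at hm), padicValNat.prime_pow,
        padicValNat.eq_zero_of_not_dvd (by rwa [← even_iff_two_dvd, Nat.not_even_iff_odd])]
      simp
    rw [h2] at h1
    omega
  rw [hvm]
  apply mul_dvd_mul (pow_dvd_pow 2 hv)
  have hc : Nat.Coprime 4 m := by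
    have : Nat.Coprime (2^2) m := Nat.Coprime.pow_left 2 (Nat.coprime_two_left.2 hm)
    simpa using this
  have hmf : m ∣ r.factorial := ⟨2^v, by rw [hvm]; ring⟩
  -- choose u with 4u = c mod m
  obtain ⟨u, hu⟩ : ∃ u : ℕ, (4 * u : ZMod m) = c := by
    have : NeZero m := ⟨by rintro rfl; simp at hm⟩
    refine ⟨((ZMod.unitOfCoprime 4 hc)⁻¹ * (c : ZMod m) : ZMod m).val, ?_⟩
    rw [ZMod.natCast_zmod_val, ← mul_assoc]
    have : (4 : ZMod m) = ((ZMod.unitOfCoprime 4 hc : (ZMod m)ˣ) : ZMod m) := by simp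
    rw [this, Units.mul_inv, one_mul]
  rw [← ZMod.natCast_eq_zero_iff]
  have h3 : ((∏ i ∈ range r, (u + i) : ℕ) : ZMod m) = 0 := by
    rw [ZMod.natCast_eq_zero_iff]
    apply hmf.trans
    rw [← Nat.ascFactorial_eq_prod_range]
    exact Nat.factorial_dvd_ascFactorial u r
  have h4 : ((∏ i ∈ range r, (c + 4*i) : ℕ) : ZMod m) = 4^r * ((∏ i ∈ range r, (u + i) : ℕ) : ZMod m) := by
    push_cast
    rw [← hu]
    conv_rhs => rw [← card_range r, ← prod_const, card_range, ← prod_mul_distrib]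
    apply prod_congr rfl
    intros; ring
  rw [h4, h3, mul_zero]

lemma q_mul (r c : ℕ) : q r c * r.factorial = 2^r * ∏ i ∈ range r, (c + 4*i) :=
  Nat.div_mul_cancel (fact_dvd r c)

def p (j k : ℕ) : ℕ := q k (4*j+3) * q j (4*k+5)

noncomputable def DD (n : ℕ) : ℝ := 2^n * (∏ i ∈ range (n+1), (4*(i:ℝ)+1)) * (∏ i ∈ range n, (4*(i:ℝ)+3))
   / ((n.factorial : ℝ)^2 * 4^(n+1))

lemma DD_pos (n : ℕ) : 0 < DD n := by unfold DD; positivity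

lemma DD_le (n : ℕ) : DD n ≤ 8^n / 4 := by
  induction n with
  | zero => simp [DD]
  | succ n ih =>
    have : DD (n+1) = DD n * (2 * (4*(n+1)+1) * (4*n+3) / (4 * (n+1)^2)) := by
      unfold DD
      rw [prod_range_succ, prod_range_succ (fun i => 4*(i:ℝ)+3), Nat.factorial_succ]
      push_cast
      field_simp
      ring
    rw [this]
    have h : (2 * (4*((n:ℝ)+1)+1) * (4*n+3) / (4 * (n+1)^2)) ≤ 8 := by
      rw [div_le_iff₀ (by positivity)]
      nlinarith
    calc DD n * (2 * (4*((n:ℝ)+1)+1) * (4*n+3) / (4 * (n+1)^2)) ≤ (8^n/4) * 8 :=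
          mul_le_mul ih h (by positivity) (by positivity)
      _ = 8^(n+1)/4 := by ring

lemma quarter_ne (j m : ℕ) : (1/4 - j + m : ℂ) ≠ 0 := by
  intro h
  have h2 : ((1 + 4*(m:ℤ) - 4*(j:ℤ) : ℤ) : ℂ) = 0 := by
    push_cast; linear_combination 4*h
  have : (1 + 4*(m:ℤ) - 4*(j:ℤ) : ℤ) = 0 := by exact_mod_cast h2
  omega

lemma prod1 (j : ℕ) : ∏ m ∈ range j, (1/4 - (j:ℂ) + m) = (-1)^j * (∏ i ∈ range j, (4*(i:ℂ)+3)) / 4^j := by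
  rw [← prod_range_reflect]
  have : ∀ m ∈ range j, (1/4 - (j:ℂ) + ((j - 1 - m : ℕ):ℂ)) = (-1/4) * (4*(m:ℂ)+3) := by
    intro m hm
    rw [mem_range] at hm
    have : (j - 1 - m : ℕ) = (j:ℤ) - 1 - m := by omega
    have : ((j - 1 - m : ℕ) : ℂ) = (j:ℂ) - 1 - m := by exact_mod_cast congrArg (Int.cast (R := ℂ)) this
    rw [this]; ring
  rw [prod_congr rfl this, prod_mul_distrib, prod_const, card_range, div_pow]
  ring

lemma prod2 (k : ℕ) : ∏ m ∈ range k, (1/4 + (m:ℂ)) = (∏ i ∈ range k, (4*(i:ℂ)+1)) / 4^k := by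
  have : ∀ m ∈ range k, (1/4 + (m:ℂ)) = (1/4) * (4*(m:ℂ)+1) := by intros; ring
  rw [prod_congr rfl this, prod_mul_distrib, prod_const, card_range, div_pow]
  ring

lemma fne (k : ℕ) : (k.factorial : ℂ) ≠ 0 := Nat.cast_ne_zero.2 (Nat.factorial_ne_zero _)

lemma p_eq (j k : ℕ) : (p j k : ℂ) = DD (j+k) * ((-1)^j * ((j+k).choose j) *
    ∑ m ∈ range (j+k+1), (-1:ℂ)^m * ((j+k).choose m) / (1/4 - j + m)) := by
  rw [pf (j+k) (1/4 - j) (fun m => quarter_ne j m)]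
  have e1 : ∏ m ∈ range (j+k+1), (1/4 - (j:ℂ) + m) =
      ((-1)^j * (∏ i ∈ range j, (4*(i:ℂ)+3)) / 4^j) * ((∏ i ∈ range (k+1), (4*(i:ℂ)+1)) / 4^(k+1)) := by
    rw [add_assoc, prod_range_add, prod1, ← prod2]
    congr 1
    apply prod_congr rfl
    intros; push_cast; ring
  have e2 : ∏ i ∈ range (j+k), (4*(i:ℂ)+3) = (∏ i ∈ range j, (4*(i:ℂ)+3)) * (∏ i ∈ range k, ((4*j+3 : ℂ) + 4*i)) := by
    rw [prod_range_add]
    congr 1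
    apply prod_congr rfl
    intros; push_cast; ring
  have e3 : ∏ i ∈ range (j+k+1), (4*(i:ℂ)+1) = (∏ i ∈ range (k+1), (4*(i:ℂ)+1)) * (∏ i ∈ range j, ((4*k+5 : ℂ) + 4*i)) := by
    rw [show j+k+1 = (k+1)+j by ring, prod_range_add]
    congr 1
    apply prod_congr rfl
    intros; push_cast; ring
  have q1 : (q k (4*j+3) : ℂ) = 2^k * (∏ i ∈ range k, ((4*j+3 : ℂ) + 4*i)) / k.factorial := by
    rw [eq_div_iff (fne _)]
    exact_mod_cast q_mul k (4*j+3)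
  have q2 : (q j (4*k+5) : ℂ) = 2^j * (∏ i ∈ range j, ((4*k+5 : ℂ) + 4*i)) / j.factorial := by
    rw [eq_div_iff (fne _)]
    exact_mod_cast q_mul j (4*k+5)
  have n1 : ∏ i ∈ range j, (4*(i:ℂ)+3) ≠ 0 := prod_ne_zero_iff.2 (fun m _ => by
    have : ((4*m+3 : ℕ) : ℂ) ≠ 0 := Nat.cast_ne_zero.2 (by omega)
    exact_mod_cast this)
  have n2 : ∏ i ∈ range (k+1), (4*(i:ℂ)+1) ≠ 0 := prod_ne_zero_iff.2 (fun m _ => by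
    have : ((4*m+1 : ℕ) : ℂ) ≠ 0 := Nat.cast_ne_zero.2 (by omega)
    exact_mod_cast this)
  have hch : (((j+k).choose j : ℕ) : ℂ) = (j+k).factorial / (j.factorial * k.factorial) := by
    rw [eq_div_iff (mul_ne_zero (fne _) (fne _)), ← mul_assoc]
    have := Nat.choose_mul_factorial_mul_factorial (Nat.le_add_right j k)
    rw [Nat.add_sub_cancel_left] at this
    exact_mod_cast this
  have hs : ((-1:ℂ)^j) ≠ 0 := pow_ne_zero _ (by norm_num)
  have f1 := fne j
  have f2 := fne k
  have f3 := fne (j+k)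
  unfold p DD
  push_cast
  rw [q1, q2, e1, e2, e3, hch]
  field_simp
  try ring

noncomputable def A (n : ℕ) (z : ℂ) : ℂ := ∑ x ∈ antidiagonal n, (p x.1 x.2 : ℂ) * z^x.1
noncomputable def B (n : ℕ) (z : ℂ) : ℂ := ∑ x ∈ antidiagonal n, (p x.1 x.2 : ℂ) * z^x.2

noncomputable def G (n : ℕ) (z : ℂ) : ℂ := ∫ t in (0:ℝ)..1,
  (z-1) * ((z - (1+t*(z-1)))^n * ((1+t*(z-1)) - 1)^n * (1+t*(z-1))^(1/4 - n - 1 : ℂ))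

lemma pt (n : ℕ) (z s : ℂ) (hs : s ≠ 0) :
    (z-1) * ((z - s)^n * (s - 1)^n * s^(1/4 - n - 1 : ℂ)) =
    ∑ j ∈ range (n+1), ∑ k ∈ range (n+1), ((-1)^j * (-1)^k * (n.choose j) * (n.choose k) * z^j) *
        ((z-1) * s^(1/4 - j + k - 1 : ℂ)) := by
  rw [sub_eq_add_neg z s, add_pow, sub_eq_add_neg s 1, add_pow, sum_mul_sum, sum_mul, mul_sum]
  apply sum_congr rfl
  intro j hj
  rw [sum_mul, mul_sum]
  apply sum_congr rfl
  intro k hk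
  obtain ⟨j', hj'⟩ := Nat.exists_eq_add_of_le (Nat.lt_succ_iff.1 (mem_range.1 hj))
  obtain ⟨k', hk'⟩ := Nat.exists_eq_add_of_le (Nat.lt_succ_iff.1 (mem_range.1 hk))
  have h1 : n - j = j' := by omega
  have h2 : n - k = k' := by omega
  rw [h1, h2, neg_pow s j']
  have h3 : s^(1/4 - j + k - 1 : ℂ) = s^(1/4 - n - 1 : ℂ) * (s^j' * s^k) := by
    rw [← pow_add, ← Complex.cpow_natCast, ← Complex.cpow_add _ _ hs]
    congr 1
    rw [hj']; push_cast; ring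
  have h4 : (-1:ℂ)^j' * (-1)^k' = (-1)^j * (-1)^k := by
    rw [← pow_add, ← pow_add]
    have : Even (j' + k') ↔ Even (j + k) := by
      have : j' + k' + (j + k) = 2 * n := by omega
      grind
    rcases Nat.even_or_odd (j+k) with h | h
    · rw [h.neg_one_pow, (this.2 h).neg_one_pow]
    · rw [h.neg_one_pow, Odd.neg_one_pow]
      rw [← Nat.not_even_iff_odd] at h ⊢
      rwa [this]
  rw [h3, ← h4]
  ring

lemma G_expand (n : ℕ) {z : ℂ} (hz : ‖z-1‖ < 1) : G n z =
    ∑ j ∈ range (n+1), ∑ k ∈ range (n+1), (-1)^j * (-1)^k * (n.choose j) * (n.choose k) *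
      ((z^(1/4:ℂ) * z^k - z^j) / (1/4 - j + k)) := by
  have hz0 : z ≠ 0 := by rintro rfl; simp at hz
  have hterm : ∀ j ∈ range (n+1), ∀ k ∈ range (n+1),
      ∫ t in (0:ℝ)..1, ((-1)^j * (-1)^k * (n.choose j) * (n.choose k) * z^j) *
        ((z-1) * (1+t*(z-1))^(1/4 - j + k - 1 : ℂ)) = (-1)^j * (-1)^k * (n.choose j) * (n.choose k) *
      ((z^(1/4:ℂ) * z^k - z^j) / (1/4 - j + k)) := by
    intro j hj k hk
    rw [intervalIntegral.integral_const_mul, int1 hz _ (by rw [sub_add_cancel]; exact quarter_ne j k),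
      sub_add_cancel]
    have : z^j * z^(1/4 - j + k : ℂ) = z^(1/4:ℂ) * z^k := by
      rw [← Complex.cpow_natCast, ← Complex.cpow_natCast, ← Complex.cpow_add _ _ hz0, ← Complex.cpow_add _ _ hz0]
      congr 1; ring
    rw [← this]; ring
  have hcont : ∀ c e : ℂ, IntervalIntegrable (fun t : ℝ => c * ((z-1) * (1+t*(z-1))^e)) MeasureTheory.volume 0 1 := by
    intro c e
    apply ContinuousOn.intervalIntegrable
    rw [Set.uIcc_of_le zero_le_one]
    intro t ht
    apply ContinuousAt.continuousWithinAt
    have := slit hz ht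
    exact continuousAt_const.mul (continuousAt_const.mul (ContinuousAt.cpow (by fun_prop) continuousAt_const this))
  rw [← sum_congr rfl (fun j hj => sum_congr rfl (fun k hk => hterm j hj k hk))]
  rw [← sum_congr rfl (fun j hj => intervalIntegral.integral_finsetSum (fun k hk => hcont _ _))]
  rw [← intervalIntegral.integral_finsetSum]
  · unfold G
    apply intervalIntegral.integral_congr
    intro t ht
    rw [Set.uIcc_of_le zero_le_one] at ht
    have hs0 := Complex.slitPlane_ne_zero (slit hz ht)
    exact pt n z _ hs0
  · intro j hj
    have := IntervalIntegrable.sum (range (n+1)) (fun k hk => hcont ((-1)^j * (-1)^k * (n.choose j) * (n.choose k) * z^j) (1/4 - j + k - 1))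
    rw [Finset.sum_fn] at this
    exact this


lemma DD_G (n : ℕ) {z : ℂ} (hz : ‖z-1‖ < 1) : DD n * G n z = z^(1/4:ℂ) * B n z - A n z := by
  have hA : A n z = ∑ j ∈ range (n+1), ∑ k ∈ range (n+1), DD n * ((-1)^j * (-1)^k * (n.choose j) * (n.choose k) *
      (z^j / (1/4 - j + k))) := by
    unfold A
    rw [Nat.sum_antidiagonal_eq_sum_range_succ (fun i j => (p i j : ℂ) * z^i)]
    apply sum_congr rfl
    intro j hj
    obtain ⟨j', hj'⟩ := Nat.exists_eq_add_of_le (Nat.lt_succ_iff.1 (mem_range.1 hj))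
    have h1 : n - j = j' := by omega
    rw [h1, p_eq, ← hj', mul_sum, mul_sum, sum_mul]
    apply sum_congr rfl
    intros; ring
  have hB : B n z = ∑ j ∈ range (n+1), ∑ k ∈ range (n+1), DD n * ((-1)^j * (-1)^k * (n.choose j) * (n.choose k) *
      (z^k / (1/4 - j + k))) := by
    unfold B
    rw [Nat.sum_antidiagonal_eq_sum_range_succ (fun i j => (p i j : ℂ) * z^j), sum_comm]
    rw [← sum_range_reflect]
    apply sum_congr rfl
    intro k hk
    rw [← sum_range_reflect]
    obtain ⟨k', hk'⟩ := Nat.exists_eq_add_of_le (Nat.lt_succ_iff.1 (mem_range.1 hk))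
    have h1 : n + 1 - 1 - k = k' := by omega
    have h2 : n - k' = k := by omega
    rw [h1, h2, p_eq, show k' + k = n by omega, mul_sum, mul_sum, sum_mul]
    apply sum_congr rfl
    intro j hj
    obtain ⟨j', hj'⟩ := Nat.exists_eq_add_of_le (Nat.lt_succ_iff.1 (mem_range.1 hj))
    have h3 : n + 1 - 1 - j = j' := by omega
    rw [h3]
    have c1 : n.choose k' = n.choose k := by
      rw [← h2]; exact (Nat.choose_symm (by omega)).symm
    have c2 : n.choose j' = n.choose j := by
      rw [show j' = n - j by omega]; exact Nat.choose_symm (by omega)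
    have h4 : (-1:ℂ)^k' * (-1)^j = (-1)^j' * (-1)^k := by
      rw [← pow_add, ← pow_add]
      have : Even (k' + j) ↔ Even (j' + k) := by
        have : k' + j + (j' + k) = 2 * n := by omega
        grind
      rcases Nat.even_or_odd (j'+k) with h | h
      · rw [h.neg_one_pow, (this.2 h).neg_one_pow]
      · rw [h.neg_one_pow, Odd.neg_one_pow]
        rw [← Nat.not_even_iff_odd] at h ⊢
        rwa [this]
    have h5 : (1/4 - (j':ℂ) + k) = 1/4 - k' + j := by
      have h6 : (n:ℂ) = j + j' := by exact_mod_cast hj'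
      have h7 : (n:ℂ) = k + k' := by exact_mod_cast hk'
      linear_combination h6 - h7
    rw [c1, c2, h5]
    linear_combination (DD n * (n.choose k) * (n.choose j) / (1/4 - k' + j) * z^k : ℂ) * h4
  rw [hA, hB, G_expand n hz, mul_sum, mul_sum, ← sum_sub_distrib]
  apply sum_congr rfl
  intro j _
  rw [mul_sum, mul_sum, ← sum_sub_distrib]
  apply sum_congr rfl
  intros; ring

lemma G_bound (n : ℕ) {z : ℂ} {δ : ℝ} (hδ : δ < 1) (hz : ‖z-1‖ ≤ δ) :
    ‖G n z‖ ≤ ‖z-1‖^(2*n+1) * (1/4)^n * ((1-δ)^(n+1))⁻¹ := by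
  have hz1 : ‖z-1‖ < 1 := lt_of_le_of_lt hz hδ
  have h0 : 0 ≤ δ := le_trans (norm_nonneg _) hz
  have key : ∀ t ∈ Set.uIoc (0:ℝ) 1,
     ‖(z-1) * ((z - (1+t*(z-1)))^n * ((1+t*(z-1)) - 1)^n * (1+t*(z-1))^(1/4 - n - 1 : ℂ))‖ ≤
      ‖z-1‖^(2*n+1) * (1/4)^n * ((1-δ)^(n+1))⁻¹ := by
    intro t ht
    rw [Set.uIoc_of_le zero_le_one] at ht
    have hs : 1 - δ ≤ ‖(1+t*(z-1) : ℂ)‖ := by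
      have h1 : ‖(t*(z-1) : ℂ)‖ ≤ δ := by
        rw [norm_mul, Complex.norm_real, Real.norm_eq_abs, abs_of_nonneg ht.1.le]
        nlinarith [ht.2, norm_nonneg (z-1)]
      have h2 := norm_sub_norm_le (1:ℂ) (-(t*(z-1)))
      rw [norm_neg, sub_neg_eq_add, norm_one] at h2
      linarith
    have e1 : z - (1+t*(z-1)) = ((1-t : ℝ) : ℂ) * (z-1) := by push_cast; ring
    have e2 : (1+t*(z-1)) - 1 = (t : ℂ) * (z-1) := by ring
    have e3 : (1/4 - n - 1 : ℂ) = ((1/4 - n - 1 : ℝ) : ℂ) := by push_cast; ring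
    rw [e1, e2, e3, norm_mul, norm_mul, Complex.norm_cpow_real, norm_mul, norm_pow, norm_pow, norm_mul, norm_mul,
      Complex.norm_real, Complex.norm_real, Real.norm_eq_abs, Real.norm_eq_abs, abs_of_nonneg ht.1.le,
      abs_of_nonneg (by linarith [ht.2] : (0:ℝ) ≤ 1 - t)]
    have hpos : 0 < 1 - δ := by linarith
    have b1 : ‖(1+t*(z-1) : ℂ)‖ ^ (1/4 - n - 1 : ℝ) ≤ ((1-δ)^(n+1))⁻¹ := by
      calc _ ≤ (1-δ)^(1/4 - n - 1 : ℝ) := Real.rpow_le_rpow_of_nonpos hpos hs (by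
              have : (0:ℝ) ≤ n := Nat.cast_nonneg n
              linarith)
        _ ≤ (1-δ)^(-((n+1 : ℕ) : ℝ)) := Real.rpow_le_rpow_of_exponent_ge hpos (by linarith) (by push_cast; linarith)
        _ = _ := by rw [Real.rpow_neg hpos.le, Real.rpow_natCast]
    have b2 : ((1-t)*t)^n ≤ (1/4)^n := by
      apply pow_le_pow_left₀
      · nlinarith [ht.1, ht.2]
      · nlinarith [sq_nonneg (t-1/2)]
    calc ‖z-1‖ * (((1-t) * ‖z-1‖)^n * (t * ‖z-1‖)^n * ‖(1+t*(z-1) : ℂ)‖ ^ (1/4 - n - 1 : ℝ))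
        = ‖z-1‖^(2*n+1) * ((1-t)*t)^n * ‖(1+t*(z-1) : ℂ)‖ ^ (1/4 - n - 1 : ℝ) := by
          rw [mul_pow, mul_pow, mul_pow]; ring
      _ ≤ _ := by gcongr
  have := intervalIntegral.norm_integral_le_of_norm_le_const key
  simpa [G] using this

lemma E_bound (n : ℕ) {z : ℂ} {δ : ℝ} (hδ : δ < 1) (hz : ‖z-1‖ ≤ δ) :
    ‖z^(1/4:ℂ) * B n z - A n z‖ ≤ 8^n/4 * (‖z-1‖^(2*n+1) * (1/4)^n * ((1-δ)^(n+1))⁻¹) := by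
  rw [← DD_G n (lt_of_le_of_lt hz hδ), norm_mul, Complex.norm_real, Real.norm_eq_abs, abs_of_pos (DD_pos n)]
  exact mul_le_mul (DD_le n) (G_bound n hδ hz) (norm_nonneg _) (by positivity)

lemma q_le (k c : ℕ) (j : ℕ) (h : c ≤ 4 * (j+1)) : q k c ≤ 8^k * (j+k).choose k := by
  have h1 : q k c * k.factorial ≤ (8^k * (j+k).choose k) * k.factorial := by
    rw [q_mul]
    calc 2^k * ∏ i ∈ range k, (c + 4*i) ≤ 2^k * ∏ i ∈ range k, (4 * (j+1+i)) := by
          apply Nat.mul_le_mul_left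
          apply prod_le_prod' 
          intros; omega
      _ = 2^k * (4^k * (j+1).ascFactorial k) := by
          rw [prod_mul_distrib, prod_const, card_range, Nat.ascFactorial_eq_prod_range]
      _ = _ := by
          rw [Nat.ascFactorial_eq_factorial_mul_choose, show (8:ℕ) = 2*4 by norm_num, mul_pow]
          ring
  exact Nat.le_of_mul_le_mul_right h1 (Nat.factorial_pos k)

lemma p_sum (n : ℕ) : ∑ x ∈ antidiagonal n, p x.1 x.2 ≤ 32^n := by
  calc ∑ x ∈ antidiagonal n, p x.1 x.2 ≤ ∑ x ∈ antidiagonal n, 8^n * ((n+1).choose x.1 * n.choose x.2) := by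
        apply sum_le_sum
        rintro ⟨j, k⟩ h
        simp only [HasAntidiagonal.mem_antidiagonal] at h
        unfold p
        have h1 := q_le k (4*j+3) j (by omega)
        have h2 := q_le j (4*k+5) (k+1) (by omega)
        have e1 : j + k = n := h
        have e2 : k + 1 + j = n+1 := by omega
        rw [e1] at h1
        rw [e2] at h2
        calc _ ≤ _ := Nat.mul_le_mul h1 h2
          _ = _ := by
            simp only
            rw [← e1, pow_add]; ring
    _ = 8^n * (2*n+1).choose n := by
        rw [← mul_sum, ← Nat.add_choose_eq]
        congr 2; ring
    _ ≤ 8^n * 4^n := Nat.mul_le_mul_left _ (Nat.choose_middle_le_pow n)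
    _ = 32^n := by rw [← mul_pow]; norm_num

open Polynomial in
lemma poly_vanish (P : ℂ[X]) : ∀ (m : ℕ) (C : ℝ), (∀ z : ℂ, ‖z-1‖ ≤ 1/2 → ‖P.eval z‖ ≤ C * ‖z-1‖^m) →
    (X - Polynomial.C 1)^m ∣ P := by
  intro m
  induction m with
  | zero => intros; simp
  | succ m ih =>
    intro K hK
    have hK0 : 0 ≤ K := by
      have := hK (3/2) (by norm_num)
      have h2 : 0 ≤ K * ‖(3/2 - 1 : ℂ)‖^(m+1) := le_trans (norm_nonneg _) this
      have h3 : 0 < ‖(3/2 - 1 : ℂ)‖^(m+1) := by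
        apply pow_pos; rw [norm_pos_iff]; norm_num
      exact nonneg_of_mul_nonneg_left h2 h3
    obtain ⟨Q, hQ⟩ := ih K (by
      intro z hz
      refine (hK z hz).trans ?_
      rw [pow_succ]
      have : 0 ≤ K * ‖z-1‖^m := by positivity
      nlinarith)
    have hb : ∀ᶠ z in nhdsWithin (1:ℂ) {1}ᶜ, ‖Q.eval z‖ ≤ K * ‖z-1‖ := by
      have : ∀ᶠ z in nhdsWithin (1:ℂ) {1}ᶜ, z ∈ Metric.closedBall (1:ℂ) (1/2) :=
        mem_nhdsWithin_of_mem_nhds (Metric.closedBall_mem_nhds _ (by norm_num))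
      filter_upwards [this, self_mem_nhdsWithin] with z hz1 hz2
      rw [Metric.mem_closedBall, dist_eq_norm] at hz1
      have h1 := hK z hz1
      rw [hQ, eval_mul, eval_pow, eval_sub, eval_X, eval_C, norm_mul, norm_pow, pow_succ] at h1
      have h2 : 0 < ‖z-1‖^m := by
        apply pow_pos; rw [norm_pos_iff, sub_ne_zero]; exact hz2
      have h3 : ‖z-1‖^m * ‖Q.eval z‖ ≤ ‖z-1‖^m * (K * ‖z-1‖) := by linarith
      exact le_of_mul_le_mul_left h3 h2
    have t1 : Filter.Tendsto (fun z => ‖Q.eval z‖) (nhdsWithin (1:ℂ) {1}ᶜ) (nhds ‖Q.eval 1‖) :=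
      (Q.continuous.norm.tendsto 1).mono_left nhdsWithin_le_nhds
    have t2 : Filter.Tendsto (fun z : ℂ => K * ‖z-1‖) (nhdsWithin (1:ℂ) {1}ᶜ) (nhds (K * ‖(1:ℂ)-1‖)) :=
      ((by fun_prop : Continuous (fun z : ℂ => K * ‖z-1‖)).tendsto 1).mono_left nhdsWithin_le_nhds
    have h0 := le_of_tendsto_of_tendsto t1 t2 hb
    rw [sub_self, norm_zero, mul_zero, norm_le_zero_iff] at h0
    obtain ⟨R, hR⟩ := dvd_iff_isRoot.2 h0
    refine ⟨R, ?_⟩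
    rw [hQ, hR, pow_succ, mul_assoc]

open Polynomial in
noncomputable def PA (n : ℕ) : ℂ[X] := ∑ x ∈ antidiagonal n, Polynomial.C (p x.1 x.2 : ℂ) * X^x.1
open Polynomial in
noncomputable def PB (n : ℕ) : ℂ[X] := ∑ x ∈ antidiagonal n, Polynomial.C (p x.1 x.2 : ℂ) * X^x.2

lemma PA_eval (n : ℕ) (z : ℂ) : (PA n).eval z = A n z := by
  simp [PA, A, Polynomial.eval_finsetSum]
lemma PB_eval (n : ℕ) (z : ℂ) : (PB n).eval z = B n z := by
  simp [PB, B, Polynomial.eval_finsetSum]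
lemma PA_deg (n : ℕ) : (PA n).natDegree ≤ n := by
  apply Polynomial.natDegree_sum_le_of_forall_le
  intro x hx
  have := mem_antidiagonal.1 hx
  exact (Polynomial.natDegree_C_mul_X_pow_le _ _).trans (by omega)
lemma PB_deg (n : ℕ) : (PB n).natDegree ≤ n := by
  apply Polynomial.natDegree_sum_le_of_forall_le
  intro x hx
  have := mem_antidiagonal.1 hx
  exact (Polynomial.natDegree_C_mul_X_pow_le _ _).trans (by omega)

lemma q_zero (c : ℕ) : q 0 c = 1 := by simp [q]
lemma A_zero (n : ℕ) : A n 0 = q n 3 := by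
  unfold A
  rw [sum_eq_single (0, n)]
  · simp [p, q_zero]
  · rintro ⟨j, k⟩ h1 h2
    have := mem_antidiagonal.1 h1
    have : j ≠ 0 := by rintro rfl; apply h2; simp at this; simp [this]
    simp [this]
  · intro h; simp at h
lemma B_zero (n : ℕ) : B n 0 = q n 5 := by
  unfold B
  rw [sum_eq_single (n, 0)]
  · simp [p, q_zero]
  · rintro ⟨j, k⟩ h1 h2
    have := mem_antidiagonal.1 h1
    have : k ≠ 0 := by rintro rfl; apply h2; simp at this; simp [this]
    simp [this]
  · intro h; simp at h

lemma q_pos (r c : ℕ) (hc : 0 < c) : 0 < q r c := by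
  have h := q_mul r c
  have : 0 < 2^r * ∏ i ∈ range r, (c + 4*i) := by
    apply Nat.mul_pos (by positivity)
    apply prod_pos; intros; omega
  rw [← h] at this
  exact Nat.pos_of_mul_pos_right this

lemma q_succ (r c : ℕ) : q (r+1) c * (r+1) = 2 * (c + 4*r) * q r c := by
  have h1 := q_mul (r+1) c
  have h2 := q_mul r c
  rw [prod_range_succ, Nat.factorial_succ] at h1
  apply Nat.eq_of_mul_eq_mul_right (Nat.factorial_pos r)
  calc _ = q (r+1) c * ((r+1) * r.factorial) := by ring
    _ = 2 * (c+4*r) * (2^r * ∏ i ∈ range r, (c + 4*i)) := by rw [h1]; ring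
    _ = _ := by rw [← h2]; ring

lemma caso (n : ℕ) {z : ℂ} (hz : z ≠ 1) : A n z * B (n+1) z - A (n+1) z * B n z ≠ 0 := by
  intro h
  set P := PA n * PB (n+1) - PA (n+1) * PB n with hP
  have hev : ∀ w, P.eval w = A n w * B (n+1) w - A (n+1) w * B n w := by
    intro w; simp [hP, PA_eval, PB_eval]
  have hdeg : P.natDegree ≤ 2*n+1 := by
    apply (Polynomial.natDegree_sub_le _ _).trans
    apply max_le
    · refine (Polynomial.natDegree_mul_le).trans ?_
      have := PA_deg n; have := PB_deg (n+1); omega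
    · refine (Polynomial.natDegree_mul_le).trans ?_
      have := PA_deg (n+1); have := PB_deg n; omega
  have hc0 : P.eval 0 ≠ 0 := by
    rw [hev, A_zero, B_zero, A_zero, B_zero]
    intro h0
    have s3 := q_succ n 3
    have s5 := q_succ n 5
    have p3 := q_pos n 3 (by norm_num)
    have p5 := q_pos n 5 (by norm_num)
    have h1 : q n 3 * q (n+1) 5 = q (n+1) 3 * q n 5 := by
      have := sub_eq_zero.1 h0
      exact_mod_cast this
    have h2 : q n 3 * (q (n+1) 5 * (n+1)) = (q (n+1) 3 * (n+1)) * q n 5 := by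
      rw [← mul_assoc, h1]; ring
    rw [s3, s5] at h2
    have : 0 < q n 3 * q n 5 := Nat.mul_pos p3 p5
    nlinarith
  -- boundedness of B
  have hBb : ∀ m : ℕ, ∃ K : ℝ, 0 ≤ K ∧ ∀ w : ℂ, ‖w-1‖ ≤ 1/2 → ‖B m w‖ ≤ K := by
    intro m
    have hc : ContinuousOn (fun w => (PB m).eval w) (Metric.closedBall (1:ℂ) (1/2)) := (PB m).continuous.continuousOn
    obtain ⟨K, hK⟩ := (isCompact_closedBall (1:ℂ) (1/2)).exists_bound_of_continuousOn hc
    refine ⟨max K 0, le_max_right _ _, fun w hw => ?_⟩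
    have := hK w (by rwa [Metric.mem_closedBall, dist_eq_norm])
    rw [PB_eval] at this
    exact this.trans (le_max_left _ _)
  obtain ⟨K1, hK10, hK1⟩ := hBb n
  obtain ⟨K2, hK20, hK2⟩ := hBb (n+1)
  have hdvd := poly_vanish P (2*n+1)
    ((8^(n+1)/4 * ((1/4)^(n+1) * ((1-1/2)^(n+1+1))⁻¹)) * K1 + (8^n/4 * ((1/4)^n * ((1-1/2)^(n+1))⁻¹)) * K2) (by
    intro w hw
    have b1 := E_bound n (by norm_num) hw
    have b2 := E_bound (n+1) (by norm_num) hw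
    have b3 : ‖w-1‖^(2*(n+1)+1) ≤ ‖w-1‖^(2*n+1) :=
      pow_le_pow_of_le_one (norm_nonneg _) (by linarith) (by omega)
    have e : P.eval w = (w^(1/4:ℂ) * B (n+1) w - A (n+1) w) * B n w - (w^(1/4:ℂ) * B n w - A n w) * B (n+1) w := by
      rw [hev]; ring
    rw [e]
    calc _ ≤ ‖w^(1/4:ℂ) * B (n+1) w - A (n+1) w‖ * ‖B n w‖ + ‖w^(1/4:ℂ) * B n w - A n w‖ * ‖B (n+1) w‖ := by
          rw [← norm_mul, ← norm_mul]; exact norm_sub_le _ _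
      _ ≤ (8^(n+1)/4 * (‖w-1‖^(2*n+1) * (1/4)^(n+1) * ((1-1/2)^(n+1+1))⁻¹)) * K1 +
           (8^n/4 * (‖w-1‖^(2*n+1) * (1/4)^n * ((1-1/2)^(n+1))⁻¹)) * K2 := by
          apply add_le_add
          · apply mul_le_mul _ (hK1 w hw) (norm_nonneg _) (by positivity)
            refine b2.trans ?_
            gcongr
          · exact mul_le_mul b1 (hK2 w hw) (norm_nonneg _) (by positivity)
      _ = _ := by ring)
  obtain ⟨Q, hQ⟩ := hdvd
  have hP0 : P ≠ 0 := by intro h0; rw [h0] at hc0; simp at hc0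
  have hQ0 : Q ≠ 0 := by rintro rfl; simp at hQ; exact hP0 hQ
  have hQd : Q.natDegree = 0 := by
    have := hQ ▸ hdeg
    rw [Polynomial.natDegree_mul (pow_ne_zero _ (Polynomial.X_sub_C_ne_zero 1)) hQ0,
      Polynomial.natDegree_pow, Polynomial.natDegree_X_sub_C] at this
    omega
  obtain ⟨c, hc⟩ := Polynomial.natDegree_eq_zero.1 hQd
  have hz0 : P.eval z = 0 := by rw [hev, h]
  rw [hQ, ← hc] at hz0
  simp [sub_eq_zero, hz] at hz0
  rw [hz0] at hc
  simp at hc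
  exact hQ0 hc.symm

lemma sqle {a b : ℝ} (h : a^2 ≤ b^2) (hb : 0 ≤ b) : a ≤ b := by
  by_contra hc
  push Not at hc
  nlinarith

lemma half {x y : ℂ} {s : ℝ} (hx : ‖x‖ = s) (hy : ‖y‖ = s) :
    ‖x - y‖ * (√2 * s) ≤ ‖x^2 - y^2‖ ∨ ‖x + y‖ * (√2 * s) ≤ ‖x^2 - y^2‖ := by
  have hpar := parallelogram_law_with_norm ℝ x y
  rw [hx, hy] at hpar
  have hs : 0 ≤ s := hx ▸ norm_nonneg x
  have e : ‖x^2 - y^2‖ = ‖x + y‖ * ‖x - y‖ := by rw [← norm_mul]; congr 1; ring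
  have h2 : √2 ^ 2 = 2 := Real.sq_sqrt (by norm_num)
  rw [e]
  rcases le_total ‖x-y‖ ‖x+y‖ with h | h
  · left
    rw [mul_comm]
    apply mul_le_mul_of_nonneg_right _ (norm_nonneg _)
    refine sqle ?_ (norm_nonneg _)
    rw [mul_pow, h2]
    nlinarith [norm_nonneg (x-y)]
  · right
    apply mul_le_mul_of_nonneg_left _ (norm_nonneg _)
    refine sqle ?_ (norm_nonneg _)
    rw [mul_pow, h2]
    nlinarith [norm_nonneg (x+y)]

lemma pick {x y : ℂ} {s : ℝ} (hx : ‖x‖ = s) (hy : ‖y‖ = s) :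
    ∃ e : GaussianInt, ‖(e:ℂ)‖ = 1 ∧ ‖x - e * y‖ * (2 * s^3) ≤ ‖x^4 - y^4‖ := by
  have hs : 0 ≤ s := hx ▸ norm_nonneg x
  have h2 : √2 ^ 2 = 2 := Real.sq_sqrt (by norm_num)
  have main : ∀ y' : ℂ, ‖y'‖ = s → ‖x^2 - y'^2‖ * (√2 * s^2) ≤ ‖x^4 - y^4‖ →
      ‖x - y'‖ * (2 * s^3) ≤ ‖x^4 - y^4‖ ∨ ‖x + y'‖ * (2 * s^3) ≤ ‖x^4 - y^4‖ := by
    intro y' hy' h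
    have h0 : 0 ≤ √2 * s^2 := by positivity
    have e : 2 * s^3 = (√2 * s) * (√2 * s^2) := by linear_combination (- s^3) * h2
    rw [e]
    rcases half hx hy' with h1 | h1
    · left
      rw [← mul_assoc]
      exact (mul_le_mul_of_nonneg_right h1 h0).trans h
    · right
      rw [← mul_assoc]
      exact (mul_le_mul_of_nonneg_right h1 h0).trans h
  have hI : ((⟨0, 1⟩ : GaussianInt) : ℂ) = Complex.I := by simp [GaussianInt.toComplex_def]
  have hq := half (x := x^2) (y := y^2) (s := s^2) (by rw [norm_pow, hx]) (by rw [norm_pow, hy])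
  have e4 : (x^2)^2 - (y^2)^2 = x^4 - y^4 := by ring
  rw [e4] at hq
  rcases hq with h | h
  · rcases main y hy h with h | h
    · exact ⟨1, by simp, by simpa using h⟩
    · exact ⟨-1, by simp, by simpa using h⟩
  · have e2 : x^2 + y^2 = x^2 - (Complex.I * y)^2 := by rw [mul_pow, Complex.I_sq]; ring
    rw [e2] at h
    rcases main (Complex.I * y) (by simp [hy]) h with h | h
    · exact ⟨⟨0, 1⟩, by rw [hI]; simp, by rw [hI]; exact h⟩
    · refine ⟨-⟨0, 1⟩, ?_, ?_⟩
      · rw [map_neg, hI]; simp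
      · rw [map_neg, hI]; simpa using h

def u : GaussianInt := ⟨-120, -119⟩
def v : GaussianInt := ⟨-119, -120⟩
def P (n : ℕ) : GaussianInt := ∑ x ∈ antidiagonal n, (p x.1 x.2 : GaussianInt) * (u^x.1 * v^x.2)
def R (n : ℕ) : GaussianInt := ∑ x ∈ antidiagonal n, (p x.1 x.2 : GaussianInt) * (u^x.2 * v^x.1)
noncomputable def z : ℂ := (u:ℂ) / v
noncomputable def ζ : ℂ := z^(1/4:ℂ)

lemma normv : ‖(v:ℂ)‖ = 169 := by
  have : ‖(v:ℂ)‖^2 = 169^2 := by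
    rw [← Complex.normSq_eq_norm_sq, GaussianInt.toComplex_def]
    simp [v, Complex.normSq_apply]; norm_num
  exact (pow_left_inj₀ (norm_nonneg _) (by norm_num) two_ne_zero).1 this
lemma normu : ‖(u:ℂ)‖ = 169 := by
  have : ‖(u:ℂ)‖^2 = 169^2 := by
    rw [← Complex.normSq_eq_norm_sq, GaussianInt.toComplex_def]
    simp [u, Complex.normSq_apply]; norm_num
  exact (pow_left_inj₀ (norm_nonneg _) (by norm_num) two_ne_zero).1 this
lemma v_ne : (v:ℂ) ≠ 0 := by rw [← norm_pos_iff, normv]; norm_num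
lemma normz : ‖z‖ = 1 := by rw [z, norm_div, normu, normv]; norm_num
lemma ζ4 : ζ^4 = z := by
  have := Complex.cpow_nat_inv_pow z (n := 4) (by norm_num)
  rw [ζ]; simp
lemma normζ : ‖ζ‖ = 1 := by
  have : ‖ζ‖^4 = 1^4 := by rw [← norm_pow, ζ4, normz]; norm_num
  exact (pow_left_inj₀ (norm_nonneg _) (by norm_num) (by norm_num)).1 this
lemma normz1 : ‖z-1‖^2 = 2/28561 := by
  have : z - 1 = ((u - v : GaussianInt) : ℂ) / v := by
    rw [z, map_sub, sub_div, div_self v_ne]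
  rw [this, norm_div, div_pow, normv, ← Complex.normSq_eq_norm_sq, GaussianInt.toComplex_def]
  simp [u, v, Complex.normSq_apply]; norm_num
lemma z_ne : z ≠ 1 := by
  intro h; have := normz1; rw [h] at this; norm_num at this
lemma normz1_le : ‖z-1‖ ≤ 1/100 := by
  refine sqle ?_ (by norm_num)
  rw [normz1]; norm_num

lemma P_eq (n : ℕ) : (P n : ℂ) = v^n * A n z := by
  unfold P A z
  rw [map_sum, mul_sum]
  apply sum_congr rfl
  rintro ⟨j, k⟩ h
  have := mem_antidiagonal.1 h
  simp only at this
  have hv := v_ne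
  rw [← this]
  simp only [map_mul, map_pow, map_natCast, div_pow, pow_add]
  field_simp
lemma R_eq (n : ℕ) : (R n : ℂ) = v^n * B n z := by
  unfold R B z
  rw [map_sum, mul_sum]
  apply sum_congr rfl
  rintro ⟨j, k⟩ h
  have := mem_antidiagonal.1 h
  simp only at this
  have hv := v_ne
  rw [← this]
  simp only [map_mul, map_pow, map_natCast, div_pow, pow_add]
  field_simp

lemma R_le (n : ℕ) : ‖(R n : ℂ)‖ ≤ 5408^n := by
  rw [R_eq, norm_mul, norm_pow, normv]
  have : ‖B n z‖ ≤ 32^n := by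
    calc _ ≤ ∑ x ∈ antidiagonal n, ‖(p x.1 x.2 : ℂ) * z^x.2‖ := norm_sum_le _ _
      _ = ((∑ x ∈ antidiagonal n, p x.1 x.2 : ℕ) : ℝ) := by
        push_cast
        apply sum_congr rfl
        intros; simp [normz]
      _ ≤ _ := by exact_mod_cast p_sum n
  calc (169:ℝ)^n * ‖B n z‖ ≤ 169^n * 32^n := by gcongr
    _ = _ := by rw [← mul_pow]; norm_num

lemma eps_le (n : ℕ) : ‖ζ * R n - P n‖ ≤ (1/40)^n / 100 := by
  have e : ζ * R n - P n = v^n * (z^(1/4:ℂ) * B n z - A n z) := by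
    rw [R_eq, P_eq, ζ]; ring
  rw [e, norm_mul, norm_pow, normv]
  calc _ ≤ (169:ℝ)^n * (8^n/4 * (‖z-1‖^(2*n+1) * (1/4)^n * ((1-1/100)^(n+1))⁻¹)) := by
        have := E_bound n (by norm_num) normz1_le
        gcongr
    _ = (169 * 8 * (2/28561) * (1/4) * (100/99))^n * (‖z-1‖ * (25/99)) := by
        rw [pow_succ ‖z-1‖, pow_mul, normz1, mul_pow, mul_pow, mul_pow, mul_pow]
        rw [pow_succ (1 - 1/100 : ℝ), mul_inv, ← inv_pow]
        norm_num
        ring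
    _ ≤ (1/40)^n * (1/100) := by
        have := normz1_le
        have := norm_nonneg (z-1)
        apply mul_le_mul _ (by linarith) (by positivity) (by positivity)
        apply pow_le_pow_left₀ (by norm_num) (by norm_num)
    _ = _ := by ring

lemma gi_norm {T : GaussianInt} (h : T ≠ 0) : 1 ≤ ‖(T:ℂ)‖ := by
  have h1 : (0:ℤ) < T.norm := GaussianInt.norm_pos.2 h
  have h2 : (1:ℝ) ≤ (T.norm : ℝ) := by exact_mod_cast h1
  have h3 : ((T.norm : ℤ) : ℝ) = ‖(T:ℂ)‖^2 := by
    rw [← Complex.normSq_eq_norm_sq, GaussianInt.intCast_real_norm]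
  nlinarith [norm_nonneg (T:ℂ)]

lemma no_approx (X Y : GaussianInt) (hX : X ≠ 0) (r : ℝ) (hr : 36 * 5408^4 ≤ r)
    (h1 : ‖(X:ℂ)‖ ≤ 4 * r) (h2 : ‖(X:ℂ) * ζ - Y‖ ≤ 3 / r^3) : False := by
  have hr0 : 0 < r := lt_of_lt_of_le (by norm_num) hr
  have hex : ∃ n : ℕ, r ≤ 40^n := by
    obtain ⟨n, hn⟩ := pow_unbounded_of_one_lt r (by norm_num : (1:ℝ) < 40)
    exact ⟨n, hn.le⟩
  classical
  obtain ⟨n, hn, hn'⟩ : ∃ n : ℕ, r ≤ 40^(n+1) ∧ 40^n < r := by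
    have hs := Nat.find_spec hex
    have hm := fun m => Nat.find_min hex (m := m)
    rcases hN : Nat.find hex with _ | n
    · rw [hN] at hs
      have : (1:ℝ) < 36 * 5408^4 := by norm_num
      norm_num at hs
      linarith
    · rw [hN] at hs
      refine ⟨n, hs, ?_⟩
      have := hm n (by omega)
      linarith
  have key : ∀ m : ℕ, n + 1 ≤ m → m ≤ n + 2 → X * P m - Y * R m = 0 := by
    intro m hm1 hm2
    by_contra hT
    have g1 := gi_norm hT
    have e : ((X * P m - Y * R m : GaussianInt) : ℂ) = ((X:ℂ) * ζ - Y) * R m - X * (ζ * R m - P m) := by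
      rw [map_sub, map_mul, map_mul]; ring
    rw [e] at g1
    have g2 : 1 ≤ 3/r^3 * 5408^m + 4 * r * ((1/40)^m/100) := by
      refine g1.trans ((norm_sub_le _ _).trans ?_)
      rw [norm_mul, norm_mul]
      exact add_le_add (mul_le_mul h2 (R_le m) (norm_nonneg _) (by positivity))
        (mul_le_mul h1 (eps_le m) (norm_nonneg _) (by positivity))
    have g3 : r * (1/40)^m ≤ 1 := by
      have : (40:ℝ)^(n+1) ≤ 40^m := pow_le_pow_right₀ (by norm_num) hm1
      rw [one_div, inv_pow, ← div_eq_mul_inv, div_le_one (by positivity)]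
      linarith
    have g4 : (5408:ℝ)^m ≤ r^3/6 := by
      refine (pow_le_pow_right₀ (by norm_num) hm2).trans ?_
      refine sqle ?_ (by positivity)
      calc ((5408:ℝ)^(n+2))^2 = 5408^4 * (5408^2)^n := by rw [← pow_mul, ← pow_mul, ← pow_add]; congr 1; ring
        _ ≤ 5408^4 * (40^5)^n := by gcongr; norm_num
        _ = 5408^4 * (40^n)^5 := by rw [← pow_mul, ← pow_mul, mul_comm 5 n]
        _ ≤ 5408^4 * r^5 := by gcongr
        _ ≤ (r/36) * r^5 := by gcongr; linarith
        _ = (r^3/6)^2 := by ring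
    have g5 : 3/r^3 * 5408^m ≤ 1/2 := by
      calc 3/r^3 * 5408^m ≤ 3/r^3 * (r^3/6) := by gcongr
        _ = 1/2 := by field_simp; norm_num
    linarith
  have k1 := key (n+1) le_rfl (by omega)
  have k2 := key (n+2) (by omega) le_rfl
  have hd : X * (P (n+1) * R (n+2) - P (n+2) * R (n+1)) = 0 := by
    linear_combination R (n+2) * k1 - R (n+1) * k2
  rcases mul_eq_zero.1 hd with h | h
  · exact hX h
  · have hh := congrArg (GaussianInt.toComplex) h
    rw [map_sub, map_mul, map_mul, map_zero, P_eq, P_eq, R_eq, R_eq] at hh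
    have : (v:ℂ)^(n+1) * v^(n+2) * (A (n+1) z * B (n+1+1) z - A (n+1+1) z * B (n+1) z) = 0 := by
      rw [← hh]; ring
    rcases mul_eq_zero.1 this with h | h
    · exact mul_ne_zero (pow_ne_zero _ v_ne) (pow_ne_zero _ v_ne) h
    · exact caso (n+1) z_ne h

lemma gi_norm_eq (T : GaussianInt) : ‖(T:ℂ)‖ = √(T.norm : ℝ) := by
  rw [GaussianInt.intCast_real_norm, Complex.normSq_eq_norm_sq, Real.sqrt_sq (norm_nonneg _)]

lemma big (g : GaussianInt) (a ε : ℤ) (hε : ε^2 = 1) (b : ℕ) (hb : 2^110 ≤ b) (hg : g.norm = b)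
    (h : (⟨1, 1⟩ : GaussianInt) * g^4 = ⟨a, ε⟩) : False := by
  set ρ : GaussianInt := ⟨3, 2⟩ with hρ
  set X : GaussianInt := g * star ρ with hX
  set Y : GaussianInt := star g * ρ with hY
  have hv : star ρ ^ 4 = v := by decide
  have hu : (⟨0, 1⟩ : GaussianInt) * ρ^4 = u := by decide
  have hρn : ρ.norm = 13 := by decide
  have hr0 : (0:ℝ) < √b := by apply Real.sqrt_pos.2; have : 0 < b := lt_of_lt_of_le (by norm_num) hb; exact_mod_cast this
  have nX : ‖(X:ℂ)‖ = √13 * √b := by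
    have : X.norm = 13 * b := by
      rw [hX, Zsqrtd.norm_mul, Zsqrtd.norm_conj, hg, hρn, mul_comm]
    rw [gi_norm_eq, this]
    push_cast
    exact Real.sqrt_mul (by norm_num) _
  have nY : ‖(Y:ℂ)‖ = √13 * √b := by
    have : Y.norm = 13 * b := by
      rw [hY, Zsqrtd.norm_mul, Zsqrtd.norm_conj, hg, hρn, mul_comm]
    rw [gi_norm_eq, this]
    push_cast
    exact Real.sqrt_mul (by norm_num) _
  have hdiff : ‖((X:ℂ) * ζ)^4 - (Y:ℂ)^4‖ = 169 * √2 := by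
    have d1 : (⟨0, 1⟩ : GaussianInt) * g^4 - (star g)^4 = ⟨-ε, ε⟩ := by
      rw [← star_pow]
      generalize g^4 = w at h
      have hre := congrArg Zsqrtd.re h
      have him := congrArg Zsqrtd.im h
      simp at hre him
      ext
      · simp; linarith
      · simp; linarith
    have d2 : ((X:ℂ) * ζ)^4 - (Y:ℂ)^4 = ((ρ^4 * (⟨-ε, ε⟩ : GaussianInt) : GaussianInt) : ℂ) := by
      have hvz : (v:ℂ) * z = u := by rw [z, mul_div_cancel₀ _ v_ne]
      rw [mul_pow, ζ4, ← map_pow, ← map_pow, hX, mul_pow, hv, map_mul, mul_assoc, hvz, ← hu, ← map_mul, ← map_sub, ← d1,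
        hY]
      congr 1
      ring
    rw [d2, gi_norm_eq]
    have : (ρ^4 * (⟨-ε, ε⟩ : GaussianInt)).norm = 169^2 * 2 := by
      rw [Zsqrtd.norm_mul, show (ρ^4).norm = 169^2 by decide, Zsqrtd.norm_def]
      simp only
      linear_combination 2 * 169^2 * hε
    rw [this]
    have c : (((169^2 * 2 : ℤ)) : ℝ) = (169:ℝ)^2 * 2 := by norm_num
    rw [c, Real.sqrt_mul (by norm_num), Real.sqrt_sq (by norm_num)]
  obtain ⟨e, he1, he2⟩ := pick (x := X * ζ) (y := Y) (s := √13 * √b) (by rw [norm_mul, normζ, nX, mul_one]) nY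
  have s13 : √13 ^ 2 = 13 := Real.sq_sqrt (by norm_num)
  have s2 : √2 ^ 2 = 2 := Real.sq_sqrt (by norm_num)
  apply no_approx X (e * Y) _ (√b)
  · apply Real.le_sqrt_of_sq_le
    have : ((2:ℝ)^110) ≤ b := by exact_mod_cast hb
    refine le_trans ?_ this
    norm_num
  · rw [nX]
    gcongr
    rw [Real.sqrt_le_left (by norm_num)]; norm_num
  · rw [map_mul GaussianInt.toComplex e Y, le_div_iff₀ (by positivity)]
    rw [hdiff] at he2
    have k1 : 169 * √2 ≤ 3 * (26 * √13) := by
      refine sqle ?_ (by positivity)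
      rw [mul_pow, mul_pow, mul_pow, s2, s13]; norm_num
    have k2 : 2 * (√13 * √b)^3 = √b^3 * (26 * √13) := by
      linear_combination (2 * √b^3 * √13) * s13
    rw [k2, ← mul_assoc] at he2
    exact le_of_mul_le_mul_right (he2.trans k1) (mul_pos (by norm_num) (Real.sqrt_pos.2 (by norm_num)))
  · intro h0
    rw [h0] at nX
    have : (0:ℝ) < √13 * √b := by positivity
    rw [← nX] at this
    simp at this

lemma gauss (a b : ℕ) (h : a^2 + 1 = 2 * b^4) : ∃ (g : GaussianInt) (c ε : ℤ), ε^2 = 1 ∧ g.norm = b ∧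
    (⟨1, 1⟩ : GaussianInt) * g^4 = ⟨c, ε⟩ := by
  obtain ⟨m, hm⟩ : Odd a := by
    rw [← Nat.not_even_iff_odd]
    rintro ⟨m, rfl⟩
    ring_nf at h
    omega
  have hb4 : 2 * (m:ℤ)^2 + 2 * m + 1 = b^4 := by
    have : (a:ℤ)^2 + 1 = 2 * b^4 := by exact_mod_cast h
    rw [hm] at this
    push_cast at this
    linarith
  set δ : GaussianInt := ⟨m+1, -m⟩ with hδ
  have hmul : δ * star δ = (b : GaussianInt)^4 := by
    have : (b : GaussianInt)^4 = ((b^4 : ℤ) : GaussianInt) := by push_cast; rfl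
    rw [this, ← hb4]
    ext
    · simp [hδ, sq]; ring
    · simp [hδ, sq]; ring
  have hcop : IsCoprime δ (star δ) := by
    refine ⟨star δ - ((m^2+m : ℤ) : GaussianInt) * ⟨1, -1⟩, - (((m^2+m : ℤ) : GaussianInt) * ⟨1, 1⟩), ?_⟩
    ext
    · simp [hδ, sq]; ring
    · simp [hδ, sq]; ring
  obtain ⟨γ, e, he⟩ := exists_associated_pow_of_mul_eq_pow' hcop hmul
  have hne : (e : GaussianInt).norm = 1 := by
    rw [Zsqrtd.norm_eq_one_iff' (by norm_num)]; exact e.isUnit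
  have hn : γ.norm = b := by
    have h1 : (γ^4 * (e:GaussianInt)).norm = b^4 := by
      rw [he, Zsqrtd.norm_def, ← hb4]; simp only [hδ]; ring
    rw [Zsqrtd.norm_mul, hne, mul_one] at h1
    have h2 : (γ^4).norm = γ.norm^4 := map_pow (Zsqrtd.normMonoidHom) γ 4
    rw [h2] at h1
    exact (pow_left_inj₀ (Zsqrtd.norm_nonneg (by norm_num) γ) (by positivity) (by norm_num)).1 h1
  generalize (e : GaussianInt) = e' at *
  have hee : γ^4 = δ * star e' := by
    have : e' * star e' = 1 := by
      rw [← Zsqrtd.norm_eq_mul_conj, hne]; rfl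
    rw [← he, mul_assoc, this, mul_one]
  obtain ⟨er, ei⟩ := e'
  rw [Zsqrtd.norm_def] at hne
  simp only at hne
  have hr : er ≤ 1 := by nlinarith [mul_self_nonneg ei]
  have hr' : -1 ≤ er := by nlinarith [mul_self_nonneg ei]
  have hi : ei ≤ 1 := by nlinarith [mul_self_nonneg er]
  have hi' : -1 ≤ ei := by nlinarith [mul_self_nonneg er]
  have hcases : (er = 1 ∧ ei = 0) ∨ (er = -1 ∧ ei = 0) ∨ (er = 0 ∧ ei = 1) ∨ (er = 0 ∧ ei = -1) := by
    interval_cases er <;> interval_cases ei <;> simp_all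
  rcases hcases with ⟨rfl, rfl⟩ | ⟨rfl, rfl⟩ | ⟨rfl, rfl⟩ | ⟨rfl, rfl⟩
  · refine ⟨γ, 2*m+1, 1, by norm_num, hn, ?_⟩
    rw [hee]
    ext
    · simp [hδ]; ring
    · simp [hδ]
  · refine ⟨γ, -(2*m+1), -1, by norm_num, hn, ?_⟩
    rw [hee]
    ext
    · simp [hδ]; ring
    · simp [hδ]
  · refine ⟨star γ, -(2*m+1), 1, by norm_num, by rw [Zsqrtd.norm_conj, hn], ?_⟩
    rw [← star_pow, hee]
    ext
    · simp [hδ]; ring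
    · simp [hδ]
  · refine ⟨star γ, (2*m+1), -1, by norm_num, by rw [Zsqrtd.norm_conj, hn], ?_⟩
    rw [← star_pow, hee]
    ext
    · simp [hδ]; ring
    · simp [hδ]

/-- solutions of the negative Pell equation -/
def pell : ℕ → ℕ × ℕ
  | 0 => (1, 1)
  | k+1 => (3 * (pell k).1 + 4 * (pell k).2, 2 * (pell k).1 + 3 * (pell k).2)

lemma pell_all (B : ℕ) : ∀ a : ℕ, a^2 + 1 = 2 * B^2 → ∃ k, pell k = (a, B) := by
  induction B using Nat.strong_induction_on with
  | _ B ih =>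
    intro a h
    rcases Nat.lt_or_ge B 3 with hB | hB
    · interval_cases B
      · omega
      · refine ⟨0, ?_⟩
        have : a = 1 := by nlinarith
        simp [pell, this]
      · have : a ≤ 2 := by nlinarith
        interval_cases a <;> omega
    · have h1 : 4 * B < 3 * a := by nlinarith
      have h2 : 2 * a < 3 * B := by nlinarith
      have h3 : B < a := by nlinarith
      obtain ⟨a', ha'⟩ := Nat.exists_eq_add_of_le h1.le
      obtain ⟨B', hB'⟩ := Nat.exists_eq_add_of_le h2.le
      obtain ⟨k, hk⟩ := ih B' (by omega) a' (by
        zify at *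
        have e1 : (a':ℤ) = 3*a - 4*B := by linarith
        have e2 : (B':ℤ) = 3*B - 2*a := by linarith
        rw [e1, e2]; linarith)
      refine ⟨k+1, ?_⟩
      simp only [pell, hk]
      ext <;> simp <;> omega

lemma pell_grow (k : ℕ) : (pell k).2 ≤ (pell k).1 ∧ 5^k ≤ (pell k).2 := by
  induction k with
  | zero => simp [pell]
  | succ k ih => simp only [pell, pow_succ]; omega

/-- Newton iteration for the integer square root, with fuel. -/
def newton (n : ℕ) : ℕ → ℕ → ℕ
  | 0, g => g
  | f+1, g => bif Nat.ble g ((g + n / g) / 2) then g else newton n f ((g + n / g) / 2)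

lemma pell_check : ∀ k < 95, k = 0 ∨ k = 3 ∨
    (newton (pell k).2 250 (pell k).2 * newton (pell k).2 250 (pell k).2 < (pell k).2 ∧
      (pell k).2 < (newton (pell k).2 250 (pell k).2 + 1) * (newton (pell k).2 250 (pell k).2 + 1)) := by
  decide +kernel

lemma ljunggren (a b : ℕ) (h : a^2 + 1 = 2 * b^4) : (a = 1 ∧ b = 1) ∨ (a = 239 ∧ b = 13) := by
  have hb : b < 2^110 := by
    by_contra hb
    obtain ⟨g, c, ε, h1, h2, h3⟩ := gauss a b h
    exact big g c ε h1 b (not_lt.1 hb) h2 h3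
  obtain ⟨k, hk⟩ := pell_all (b^2) a (by rw [h]; ring)
  have hk95 : k < 95 := by
    by_contra hc
    have h1 := (pell_grow k).2
    rw [hk] at h1
    simp only at h1
    have h2 : 5^95 ≤ 5^k := Nat.pow_le_pow_right (by norm_num) (not_lt.1 hc)
    have h3 : b^2 < (2^110)^2 := Nat.pow_lt_pow_left hb (by norm_num)
    have h4 : (2^110)^2 < 5^95 := by norm_num
    omega
  rcases pell_check k hk95 with rfl | rfl | h'
  · simp [pell] at hk
    left
    refine ⟨hk.1.symm, ?_⟩
    nlinarith [hk.2]
  · simp [pell] at hk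
    right
    refine ⟨hk.1.symm, ?_⟩
    nlinarith [hk.2]
  · rw [hk] at h'
    exfalso
    simp only at h'
    generalize newton (b^2) 250 (b^2) = r at h'
    obtain ⟨h1, h2⟩ := h'
    have h3 : r < b := by nlinarith
    have h4 : b < r + 1 := by nlinarith
    omega

end Ljung

theorem m5_n4_solution (x y : ℕ) (hx : 0 < x) (hy : 1 < y)
    (heq : x ^ 2 * (x + 1) = 2 * y ^ 4) : x = 57121 ∧ y = 3107 := by
  rcases Nat.even_or_odd' x with ⟨w, rfl | rfl⟩
  · exfalso
    have h1 : (2 * w^2) * (2*w+1) = y^4 := by nlinarith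
    have hc : Nat.Coprime (2 * w^2) (2*w+1) := by
      have h2 : Nat.Coprime (2*w) (2*w+1) := by simp
      exact Nat.Coprime.mul_left (Nat.Coprime.coprime_mul_right h2)
        (Nat.Coprime.pow_left 2 (Nat.Coprime.coprime_mul_left h2))
    obtain ⟨c, hcc⟩ := exists_eq_pow_of_mul_eq_pow (Nat.isUnit_iff.2 hc) h1
    have hw : w ≠ 0 := by rintro rfl; simp at hx
    have h3 := congrArg (padicValNat 2) hcc
    have hc0 : c ≠ 0 := by rintro rfl; simp [hw] at hcc
    rw [padicValNat.mul (by norm_num) (by positivity), padicValNat.pow, padicValNat.pow, padicValNat.self (by norm_num)] at h3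
    omega
  · have h1 : (2*w+1)^2 * (w+1) = y^4 := by nlinarith
    have hc : Nat.Coprime ((2*w+1)^2) (w+1) := by
      apply Nat.Coprime.pow_left
      have : 2*w+1 = w + (w+1) := by ring
      rw [this]; simp
    obtain ⟨c, hcc⟩ := exists_eq_pow_of_mul_eq_pow (Nat.isUnit_iff.2 hc) h1
    obtain ⟨d, hd⟩ := exists_eq_pow_of_mul_eq_pow (Nat.isUnit_iff.2 hc.symm) ((mul_comm _ _).trans h1)
    have hxc : 2*w+1 = c^2 := by
      apply (Nat.pow_left_injective (n := 2) (by norm_num))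
      simp only; rw [hcc]; ring
    have hyc : y = c * d := by
      apply (Nat.pow_left_injective (n := 4) (by norm_num))
      simp only; rw [← h1, hcc, hd]; ring
    rcases Ljung.ljunggren c d (by rw [← hxc, ← hd]; ring) with ⟨rfl, rfl⟩ | ⟨rfl, rfl⟩
    · omega
    · rw [hxc, hyc]; norm_num
end
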